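/- arXiv:1903.07548 — 2 statements merged into one kernel-verified Lean document; each statement's English description precedes it below -/
import Mathlib

section
/- Let Σ=(Γ=(V,E),σ) be a signed graph with an orientation ω compatible with σ and let G be a finite additive abelian group. Let p_Σ(G) denote the number of nowhere-zero G-potential differences of Σ, and for u ∈ G let p_Σ(G;u) denote the number of nowhere-zero G-tensions f of Σ such that for every closed walk W=(v₁,e₁,…,v_k,e_k,v₁) around an unbalanced cycle of Σ one has Σ_{i=1}^k f(e_i) ∈ u+2G. Then p_Σ(G) = (−1)^{r(Γ)} · |2G|^{k_u(Σ)} · T_Σ(1−|G|, 0, 1−1/|2G|), and for u ∉ 2G, p_Σ(G;u) = (−1)^{r(Γ)} · |2G|^{k_u(Σ)} · T_Σ(1−|G|, 0, 1), where r(Γ)=|V|−k(Γ). In particular, when Σ is connected and unbalanced, the number t_Σ(G) of nowhere-zero G-tensions of Σ satisfies t_Σ(G) = (−1)^{r(Γ)} · |2G| · [ T_Σ(1−|G|, 0, 1−1/|2G|) + (|G|/|2G| − 1) · T_Σ(1−|G|, 0, 1) ]. -/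
attribute [local instance] Classical.propDecidable

noncomputable section SignedGraphs

/-- A signed graph: a multigraph with ordered pairs of endpoints (the order is
an artefact of the encoding) together with a sign `±1` on each edge. -/
structure SGraph (V : Type*) (E : Type*) where
  ends : E → V × V
  sign : E → ℤˣ

namespace SGraph

variable {V E : Type*}

/-- Endpoint of `e` on side `b`; a loop has both endpoints equal, but its two
half-edges are distinguished by the side `b`. -/
def endpt (Γ : SGraph V E) (e : E) (b : Bool) : V :=
  cond b (Γ.ends e).1 (Γ.ends e).2

/-- `e` is a loop of the underlying graph. -/
def IsLoop (Γ : SGraph V E) (e : E) : Prop := (Γ.ends e).1 = (Γ.ends e).2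

/-- Walks in a signed multigraph: a step traverses an edge `e` in direction `d`
(from the side-`d` endpoint to the other endpoint). -/
inductive Walk (Γ : SGraph V E) : V → V → Type _
  | nil (v : V) : Walk Γ v v
  | cons (e : E) (d : Bool) {w : V} (p : Walk Γ (Γ.endpt e (!d)) w) : Walk Γ (Γ.endpt e d) w

namespace Walk

variable {Γ : SGraph V E}

/-- The list of vertices visited by a walk (including the final one). -/
def verts : ∀ {u v : V}, Γ.Walk u v → List V
  | _, _, .nil x => [x]
  | _, _, .cons e d p => Γ.endpt e d :: p.verts

/-- The list of edges traversed by a walk. -/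
def edges : ∀ {u v : V}, Γ.Walk u v → List E
  | _, _, .nil _ => []
  | _, _, .cons e _ p => e :: p.edges

/-- The list of (edge, direction) steps of a walk. -/
def steps : ∀ {u v : V}, Γ.Walk u v → List (E × Bool)
  | _, _, .nil _ => []
  | _, _, .cons e d p => (e, d) :: p.steps

/-- The sources of the steps of a walk, i.e. all visited vertices except the last. -/
def srcs {u v : V} (W : Γ.Walk u v) : List V := W.verts.dropLast

/-- The sign of a walk: the product of the signs of its edges. -/
def sgn : ∀ {u v : V}, Γ.Walk u v → ℤˣ
  | _, _, .nil _ => 1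
  | _, _, .cons e _ p => Γ.sign e * p.sgn

/-- Concatenation of walks. -/
def append : ∀ {u v w : V}, Γ.Walk u v → Γ.Walk v w → Γ.Walk u w
  | _, _, _, .nil _, q => q
  | _, _, _, .cons e d p, q => .cons e d (p.append q)

/-- The sum `Σᵢ f(eᵢ)` of the values of `f` on the edges of the walk,
with multiplicity. -/
def edgeSum {G : Type*} [AddCommGroup G] (f : E → G) {u v : V} (W : Γ.Walk u v) : G :=
  (W.edges.map f).sum

/-- The sum `Σᵢ ω(vᵢ,eᵢ)·(Π_{j<i} σ(eⱼ))·f(eᵢ)` along a walk, where `ω(vᵢ,eᵢ)`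
is the value of `ω` on the half-edge by which the walk leaves `vᵢ`. -/
def tensionSum {G : Type*} [AddCommGroup G] (ω : E → Bool → ℤˣ) (f : E → G) :
    ∀ {u v : V}, Γ.Walk u v → G
  | _, _, .nil _ => 0
  | _, _, .cons e d p => ((ω e d : ℤ) • f e) + ((Γ.sign e : ℤ) • tensionSum ω f p)

/-- `Q` is the reverse of the walk `P`. -/
def IsReverseOf {u v : V} (Q : Γ.Walk v u) (P : Γ.Walk u v) : Prop :=
  Q.steps = P.steps.reverse.map fun s => (s.1, !s.2)

end Walk

/-- A closed walk is a cycle if it is nontrivial, visits no vertex twice and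
uses no edge twice. -/
def IsCycle (Γ : SGraph V E) {v : V} (W : Γ.Walk v v) : Prop :=
  W.edges ≠ [] ∧ W.srcs.Nodup ∧ W.edges.Nodup

/-- A balanced (positive) cycle. -/
def IsBalancedCycle (Γ : SGraph V E) {v : V} (W : Γ.Walk v v) : Prop :=
  Γ.IsCycle W ∧ W.sgn = 1

/-- An unbalanced (negative) cycle. -/
def IsUnbalancedCycle (Γ : SGraph V E) {v : V} (W : Γ.Walk v v) : Prop :=
  Γ.IsCycle W ∧ W.sgn = -1

/-- A nontrivial walk that is a simple path (all visited vertices distinct). -/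
def IsPathWalk (Γ : SGraph V E) {u v : V} (P : Γ.Walk u v) : Prop :=
  P.edges ≠ [] ∧ P.verts.Nodup

/-- A tight handcuff at `v`: two edge-disjoint unbalanced cycles sharing exactly
the vertex `v`. -/
def IsTightHandcuff (Γ : SGraph V E) {v : V} (C₁ C₂ : Γ.Walk v v) : Prop :=
  Γ.IsUnbalancedCycle C₁ ∧ Γ.IsUnbalancedCycle C₂ ∧
    (∀ x ∈ C₁.srcs, x ∈ C₂.srcs → x = v) ∧ ∀ e ∈ C₁.edges, e ∉ C₂.edges

/-- A loose handcuff: two vertex-disjoint unbalanced cycles `C₁` (at `u`) and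
`C₂` (at `w`) joined by a simple path `P` from `u` to `w` meeting the cycles
exactly in its endpoints. -/
def IsLooseHandcuff (Γ : SGraph V E) {u w : V} (C₁ : Γ.Walk u u) (P : Γ.Walk u w)
    (C₂ : Γ.Walk w w) : Prop :=
  Γ.IsUnbalancedCycle C₁ ∧ Γ.IsUnbalancedCycle C₂ ∧ Γ.IsPathWalk P ∧
    (∀ x ∈ C₁.srcs, x ∉ C₂.srcs) ∧
    (∀ x ∈ P.verts, x ∈ C₁.srcs → x = u) ∧
    (∀ x ∈ P.verts, x ∈ C₂.srcs → x = w) ∧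
    ∀ e ∈ P.edges, e ∉ C₁.edges ∧ e ∉ C₂.edges

/-- The canonical closed walks traversing a circuit of the signed graph:
a balanced cycle, a tight handcuff `C₁ * C₂`, or a loose handcuff
`C₁ * P * C₂ * P⁻¹` (the circuit path edges being used twice). -/
def IsBasicCircuitWalk (Γ : SGraph V E) {v : V} (W : Γ.Walk v v) : Prop :=
  Γ.IsBalancedCycle W ∨
    (∃ C₁ C₂ : Γ.Walk v v, Γ.IsTightHandcuff C₁ C₂ ∧ W = C₁.append C₂) ∨
    ∃ (w : V) (C₁ : Γ.Walk v v) (P : Γ.Walk v w) (C₂ : Γ.Walk w w) (Q : Γ.Walk w v),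
      Γ.IsLooseHandcuff C₁ P C₂ ∧ Q.IsReverseOf P ∧
        W = C₁.append (P.append (C₂.append Q))

/-- A circuit walk: a rotation of a basic circuit walk. -/
def IsCircuitWalk (Γ : SGraph V E) {v : V} (W : Γ.Walk v v) : Prop :=
  ∃ (u : V) (A : Γ.Walk u v) (B : Γ.Walk v u),
    W = B.append A ∧ Γ.IsBasicCircuitWalk (A.append B)

/-- `e` is a circuit path edge: it lies on the connecting path of an unbalanced
loose handcuff. -/
def IsCircuitPathEdge (Γ : SGraph V E) (e : E) : Prop :=
  ∃ (u w : V) (C₁ : Γ.Walk u u) (P : Γ.Walk u w) (C₂ : Γ.Walk w w),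
    Γ.IsLooseHandcuff C₁ P C₂ ∧ e ∈ P.edges

/-- Adjacency via an edge. -/
def Adj (Γ : SGraph V E) (a b : V) : Prop := ∃ e, Γ.ends e = (a, b) ∨ Γ.ends e = (b, a)

/-- The set of connected components. -/
def Components (Γ : SGraph V E) : Type _ := Quot Γ.Adj

/-- The connected component of a vertex. -/
def comp (Γ : SGraph V E) (v : V) : Γ.Components := Quot.mk _ v

/-- The number `k(Γ)` of connected components. -/
def kAll (Γ : SGraph V E) : ℕ := Nat.card Γ.Components

/-- A connected component is balanced if every cycle it contains is balanced. -/
def IsBalancedComponent (Γ : SGraph V E) (c : Γ.Components) : Prop :=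
  ∀ v : V, Γ.comp v = c → ∀ W : Γ.Walk v v, Γ.IsCycle W → W.sgn = 1

/-- The number `k_b(Σ)` of balanced connected components. -/
def kb (Γ : SGraph V E) : ℕ := Nat.card {c : Γ.Components // Γ.IsBalancedComponent c}

/-- The number `k_u(Σ)` of unbalanced connected components. -/
def ku (Γ : SGraph V E) : ℕ := Nat.card {c : Γ.Components // ¬ Γ.IsBalancedComponent c}

/-- A signed graph is balanced if all its cycles are balanced. -/
def Balanced (Γ : SGraph V E) : Prop :=
  ∀ (v : V) (W : Γ.Walk v v), Γ.IsCycle W → W.sgn = 1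

/-- A signed graph is connected if it has exactly one connected component. -/
def Connected (Γ : SGraph V E) : Prop := Γ.kAll = 1

/-- The spanning subgraph `Σ \ Aᶜ` with edge set `A`. -/
def restrict (Γ : SGraph V E) (A : Set E) : SGraph V A :=
  { ends := fun e => Γ.ends e, sign := fun e => Γ.sign e }

/-- The signed Tutte polynomial (as a function of `x`, `y`, `z`):
`T_Σ(X,Y,Z) = Σ_{A⊆E} (X−1)^{k(Σ\Aᶜ)−k(Σ)} (Y−1)^{|A|−|V|+k_b(Σ\Aᶜ)} (Z−1)^{k_u(Σ\Aᶜ)}`. -/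
def signedTutte {K : Type*} [CommRing K] (Γ : SGraph V E) (x y z : K) : K :=
  ∑ᶠ A : Finset E,
    (x - 1) ^ ((Γ.restrict (A : Set E)).kAll - Γ.kAll) *
      (y - 1) ^ ((A.card + (Γ.restrict (A : Set E)).kb) - Nat.card V) *
        (z - 1) ^ (Γ.restrict (A : Set E)).ku

/-- Deletion of an edge. -/
def deleteEdge (Γ : SGraph V E) (e : E) : SGraph V {e' : E // e' ≠ e} :=
  { ends := fun e' => Γ.ends e'.1, sign := fun e' => Γ.sign e'.1 }

/-- The relation identifying the two endpoints of `e`. -/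
def contractRel (Γ : SGraph V E) (e : E) (a b : V) : Prop := (a, b) = Γ.ends e

/-- Contraction of an edge: the two endpoints are identified and the edge is
deleted.  (For a loop this is just deletion, as the identification is trivial.) -/
def contract (Γ : SGraph V E) (e : E) : SGraph (Quot (Γ.contractRel e)) {e' : E // e' ≠ e} :=
  { ends := fun e' => (Quot.mk _ (Γ.ends e'.1).1, Quot.mk _ (Γ.ends e'.1).2),
    sign := fun e' => Γ.sign e'.1 }

/-- `e` is a bridge: its deletion increases the number of connected components. -/
def IsBridge (Γ : SGraph V E) (e : E) : Prop := Γ.kAll < (Γ.deleteEdge e).kAll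

/-- An orientation of the half-edges, compatible with the signature. -/
def IsCompatible (Γ : SGraph V E) (ω : E → Bool → ℤˣ) : Prop :=
  ∀ e, Γ.sign e = -(ω e true * ω e false)

/-- A `G`-flow: Kirchhoff's law holds at every vertex. -/
def IsFlow (Γ : SGraph V E) (ω : E → Bool → ℤˣ) {G : Type*} [AddCommGroup G]
    (f : E → G) : Prop :=
  ∀ v : V,
    (∑ᶠ e : E, ((if Γ.endpt e true = v then (ω e true : ℤ) • f e else 0) +
      (if Γ.endpt e false = v then (ω e false : ℤ) • f e else 0))) = 0

/-- A `G`-tension: the alternating sum along every circuit walk vanishes. -/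
def IsTension (Γ : SGraph V E) (ω : E → Bool → ℤˣ) {G : Type*} [AddCommGroup G]
    (f : E → G) : Prop :=
  ∀ (v : V) (W : Γ.Walk v v), Γ.IsCircuitWalk W → W.tensionSum ω f = 0

end SGraph

/-- The doubling homomorphism `x ↦ x + x = 2x` of an abelian group. -/
def doubleHom (G : Type*) [AddCommGroup G] : G →+ G :=
  AddMonoidHom.mk' (fun x => x + x) (fun a b => add_add_add_comm a b a b)

/-- The subgroup `2G = {2x : x ∈ G}`. -/
def twoG (G : Type*) [AddCommGroup G] : AddSubgroup G := (doubleHom G).range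

/-- The `2`-torsion subgroup `G₂ = {x ∈ G : 2x = 0}`. -/
def torsion2 (G : Type*) [AddCommGroup G] : AddSubgroup G := (doubleHom G).ker

namespace SGraph

variable {V E : Type*}

/-- A `G`-potential difference: a `G`-tension whose sum around every unbalanced
cycle lies in `2G`. -/
def IsPotentialDifference (Γ : SGraph V E) (ω : E → Bool → ℤˣ) {G : Type*} [AddCommGroup G]
    (f : E → G) : Prop :=
  Γ.IsTension ω f ∧
    ∀ (v : V) (W : Γ.Walk v v), Γ.IsUnbalancedCycle W → W.edgeSum f ∈ twoG G

end SGraph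

namespace SGraph

variable {V E : Type*}

/-- Proper coloring by elements of a set `X` with involution `ι`: adjacent
endpoints of a positive edge get different colors, and for a negative edge the
`ι`-image of one endpoint's color differs from the other endpoint's color. -/
def IsProperInvColoring (Γ : SGraph V E) {X : Type*} (ι : X → X) (f : V → X) : Prop :=
  ∀ e : E, (Γ.sign e = 1 → f ((Γ.ends e).1) ≠ f ((Γ.ends e).2)) ∧
    (Γ.sign e = -1 → ι (f ((Γ.ends e).1)) ≠ f ((Γ.ends e).2))

/-- A proper `G`-coloring: for every edge `e = uv`, `f(u) ≠ f(v)` if `e` is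
positive and `-f(u) ≠ f(v)` if `e` is negative, i.e. `σ(e)•f(u) ≠ f(v)`. -/
def IsProperColoring (Γ : SGraph V E) {G : Type*} [AddCommGroup G] (f : V → G) : Prop :=
  ∀ e : E, ((Γ.sign e : ℤ) • f ((Γ.ends e).1)) ≠ f ((Γ.ends e).2)

/-- Zaslavsky's proper `n`-coloring: colors in `{0, ±1, …, ±n}` with
`f(u) ≠ σ(e)·f(v)` for every edge `e = uv`. -/
def IsProperNColoring (Γ : SGraph V E) (n : ℕ) (f : V → ℤ) : Prop :=
  (∀ v, |f v| ≤ (n : ℤ)) ∧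
    ∀ e : E, f ((Γ.ends e).1) ≠ (Γ.sign e : ℤ) * f ((Γ.ends e).2)

/-- `T ⊆ E` is a spanning tree: the spanning subgraph `(V,T)` is connected and
contains no cycle. -/
def IsSpanningTree (Γ : SGraph V E) (T : Set E) : Prop :=
  (Γ.restrict T).Connected ∧
    ∀ (v : V) (W : (Γ.restrict T).Walk v v), ¬ (Γ.restrict T).IsCycle W

/-- A connected basis of a connected signed graph: a spanning tree if `Σ` is
balanced; otherwise a spanning tree plus one extra edge closing an unbalanced
cycle. -/
def IsConnectedBasis (Γ : SGraph V E) (B : Set E) : Prop :=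
  (Γ.Balanced ∧ Γ.IsSpanningTree B) ∨
    (¬ Γ.Balanced ∧ ∃ (T : Set E) (e : E), Γ.IsSpanningTree T ∧ e ∉ T ∧ B = insert e T ∧
      ∀ (v : V) (W : (Γ.restrict B).Walk v v), (Γ.restrict B).IsCycle W → W.sgn = -1)

/-- Switching at a vertex `v`: the sign of every non-loop edge incident with `v`
is negated; loops keep their sign. -/
def switchAt (Γ : SGraph V E) (v : V) : SGraph V E :=
  { ends := Γ.ends,
    sign := fun e => if ((Γ.ends e).1 = v ↔ (Γ.ends e).2 = v) then Γ.sign e else -Γ.sign e }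

/-- Switching at a set `S` of vertices (the composite of the switchings at the
vertices of `S`): the sign of an edge is negated iff exactly one of its
endpoints lies in `S`. -/
def switchSet (Γ : SGraph V E) (S : Set V) : SGraph V E :=
  { ends := Γ.ends,
    sign := fun e => if ((Γ.ends e).1 ∈ S ↔ (Γ.ends e).2 ∈ S) then Γ.sign e else -Γ.sign e }

/-- Isomorphism of signed graphs (as undirected signed multigraphs). -/
def Iso {V₁ E₁ V₂ E₂ : Type*} (Γ₁ : SGraph V₁ E₁) (Γ₂ : SGraph V₂ E₂) : Prop :=
  ∃ (φ : V₁ ≃ V₂) (ψ : E₁ ≃ E₂), ∀ e : E₁,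
    (Γ₂.ends (ψ e) = (φ (Γ₁.ends e).1, φ (Γ₁.ends e).2) ∨
      Γ₂.ends (ψ e) = (φ (Γ₁.ends e).2, φ (Γ₁.ends e).1)) ∧
    Γ₂.sign (ψ e) = Γ₁.sign e

/-- Switching equivalence: isomorphism after switching at a set of vertices. -/
def SwitchEquiv {V₁ E₁ V₂ E₂ : Type*} (Γ₁ : SGraph V₁ E₁) (Γ₂ : SGraph V₂ E₂) : Prop :=
  ∃ S : Set V₁, Iso (Γ₁.switchSet S) Γ₂

/-- Disjoint union of signed graphs. -/
def disjUnion {V₁ E₁ V₂ E₂ : Type*} (Γ₁ : SGraph V₁ E₁) (Γ₂ : SGraph V₂ E₂) :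
    SGraph (V₁ ⊕ V₂) (E₁ ⊕ E₂) where
  ends := fun e => match e with
    | .inl e => (Sum.inl (Γ₁.ends e).1, Sum.inl (Γ₁.ends e).2)
    | .inr e => (Sum.inr (Γ₂.ends e).1, Sum.inr (Γ₂.ends e).2)
  sign := fun e => match e with
    | .inl e => Γ₁.sign e
    | .inr e => Γ₂.sign e

/-- The difference operator `δ : G^V → G^E`,
`(δg)(e) = ω(v,e)·g(v) + ω(u,e)·g(u)` for `e = uv`. -/
def deltaHom (Γ : SGraph V E) (ω : E → Bool → ℤˣ) (G : Type*) [AddCommGroup G] :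
    (V → G) →+ (E → G) :=
  AddMonoidHom.mk'
    (fun g e => (ω e true : ℤ) • g ((Γ.ends e).1) + (ω e false : ℤ) • g ((Γ.ends e).2))
    (by
      intro a b
      funext e
      simp only [Pi.add_apply, smul_add]
      abel)

end SGraph

end SignedGraphs

namespace SGraph

section Walks

variable {V E : Type} {Γ : SGraph V E}

namespace Walk

/-- Length of a walk. -/
def len {u v : V} (W : Γ.Walk u v) : ℕ := W.edges.length

@[simp] theorem len_nil (v : V) : (Walk.nil v : Γ.Walk v v).len = 0 := rfl
@[simp] theorem len_cons (e : E) (d : Bool) {w : V} (p : Γ.Walk (Γ.endpt e (!d)) w) :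
    (Walk.cons e d p).len = p.len + 1 := rfl

theorem verts_ne_nil {u v : V} (W : Γ.Walk u v) : W.verts ≠ [] := by
  cases W <;> simp [verts]

@[simp] theorem srcs_nil (v : V) : (Walk.nil v : Γ.Walk v v).srcs = [] := rfl
@[simp] theorem srcs_cons (e : E) (d : Bool) {w : V} (p : Γ.Walk (Γ.endpt e (!d)) w) :
    (Walk.cons e d p).srcs = Γ.endpt e d :: p.srcs := by
  simp only [srcs, verts]
  exact List.dropLast_cons_of_ne_nil p.verts_ne_nil

theorem verts_eq {u v : V} (W : Γ.Walk u v) : W.verts = W.srcs ++ [v] := by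
  induction W with
  | nil v => rfl
  | cons e d p ih => simp [verts, ih]

@[simp] theorem len_append {u v w : V} (p : Γ.Walk u v) (q : Γ.Walk v w) :
    (p.append q).len = p.len + q.len := by
  induction p with
  | nil v => simp [append]
  | cons e d p ih => simp [append, ih]; omega

@[simp] theorem sgn_append {u v w : V} (p : Γ.Walk u v) (q : Γ.Walk v w) :
    (p.append q).sgn = p.sgn * q.sgn := by
  induction p with
  | nil v => simp [append, sgn]
  | cons e d p ih => simp [append, sgn, ih, mul_assoc]

@[simp] theorem srcs_append {u v w : V} (p : Γ.Walk u v) (q : Γ.Walk v w) :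
    (p.append q).srcs = p.srcs ++ q.srcs := by
  induction p with
  | nil v => simp [append]
  | cons e d p ih => simp [append, ih]

@[simp] theorem edges_append {u v w : V} (p : Γ.Walk u v) (q : Γ.Walk v w) :
    (p.append q).edges = p.edges ++ q.edges := by
  induction p with
  | nil v => simp [append, edges]
  | cons e d p ih => simp [append, edges, ih]

@[simp] theorem steps_append {u v w : V} (p : Γ.Walk u v) (q : Γ.Walk v w) :
    (p.append q).steps = p.steps ++ q.steps := by
  induction p with
  | nil v => simp [append, steps]
  | cons e d p ih => simp [append, steps, ih]

theorem append_assoc {u v w x : V} (p : Γ.Walk u v) (q : Γ.Walk v w) (r : Γ.Walk w x) :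
    (p.append q).append r = p.append (q.append r) := by
  induction p with
  | nil v => simp [append]
  | cons e d p ih => simp [append, ih]

@[simp] theorem append_nil {u v : V} (p : Γ.Walk u v) : p.append (.nil v) = p := by
  induction p with
  | nil v => simp [append]
  | cons e d p ih => simp [append, ih]

@[simp] theorem nil_append {u v : V} (p : Γ.Walk u v) : (Walk.nil u).append p = p := rfl

/-- The reverse of a single step. -/
def revStep (Γ : SGraph V E) (e : E) : (d : Bool) → Γ.Walk (Γ.endpt e (!d)) (Γ.endpt e d)
  | true => .cons e false (.nil _)
  | false => .cons e true (.nil _)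

/-- Reverse of a walk. -/
def rev : ∀ {u v : V}, Γ.Walk u v → Γ.Walk v u
  | _, _, .nil v => .nil v
  | _, _, .cons e d p => p.rev.append (revStep Γ e d)

theorem rev_isReverseOf {u v : V} (p : Γ.Walk u v) : p.rev.IsReverseOf p := by
  induction p with
  | nil v => simp [rev, IsReverseOf, steps]
  | cons e d p ih =>
    simp only [IsReverseOf] at ih
    simp only [IsReverseOf, rev, steps_append, ih, steps, List.reverse_cons, List.map_append]
    cases d <;> simp [revStep, steps]

theorem rev_append {u v w : V} (p : Γ.Walk u v) (q : Γ.Walk v w) :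
    (p.append q).rev = q.rev.append p.rev := by
  induction p with
  | nil v => simp [append, rev]
  | cons e d p ih => simp [append, rev, ih, append_assoc]

@[simp] theorem len_rev {u v : V} (p : Γ.Walk u v) : p.rev.len = p.len := by
  induction p with
  | nil v => rfl
  | cons e d p ih => cases d <;> simp [rev, ih, revStep]

@[simp] theorem sgn_rev {u v : V} (p : Γ.Walk u v) : p.rev.sgn = p.sgn := by
  induction p with
  | nil v => rfl
  | cons e d p ih => cases d <;> simp [rev, ih, revStep, sgn, mul_comm]

theorem sgn_eq_steps {u v : V} (p : Γ.Walk u v) :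
    p.sgn = (p.steps.map fun s => Γ.sign s.1).prod := by
  induction p with
  | nil v => rfl
  | cons e d p ih => simp [sgn, steps, ih]

theorem IsReverseOf.sgn_eq {u v : V} {Q : Γ.Walk v u} {P : Γ.Walk u v} (h : Q.IsReverseOf P) :
    Q.sgn = P.sgn := by
  rw [sgn_eq_steps, sgn_eq_steps, h]
  simp only [List.map_map, List.map_reverse, List.prod_reverse]
  rfl

theorem eq_of_len {u v : V} (p : Γ.Walk u v) (h : p.len = 0) : u = v := by
  cases p with
  | nil => rfl
  | cons e d p => simp at h

theorem eq_nil_of_len {u : V} (p : Γ.Walk u u) (h : p.len = 0) : p = .nil u := by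
  have : ∀ {u v : V} (p : Γ.Walk u v) (_ : p.len = 0) (huv : u = v), p = huv ▸ .nil u := by
    intro u v p h huv
    cases p with
    | nil => rfl
    | cons e d p => simp at h
  exact this p h rfl

theorem len_pos_of_ne {u v : V} (p : Γ.Walk u v) (h : u ≠ v) : 0 < p.len := by
  rcases Nat.eq_zero_or_pos p.len with h0 | h0
  · exact absurd (eq_of_len p h0) h
  · exact h0

theorem edges_ne_nil {u v : V} (p : Γ.Walk u v) (h : 0 < p.len) : p.edges ≠ [] := by
  intro h0; simp [len, h0] at h

theorem src_mem {u v : V} (p : Γ.Walk u v) (h : 0 < p.len) : u ∈ p.srcs := by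
  cases p with
  | nil => simp at h
  | cons e d p => simp

theorem start_mem_verts {u v : V} (p : Γ.Walk u v) : u ∈ p.verts := by
  cases p <;> simp [verts]

theorem src_mem_of_eq {u v x : V} (p : Γ.Walk u v) (h : 0 < p.len) (hx : u = x) : x ∈ p.srcs := by
  subst hx; exact src_mem p h

theorem steps_of_len {u v : V} (p : Γ.Walk u v) (h : p.len = 0) : p.steps = [] := by
  cases p with
  | nil => rfl
  | cons e d p => simp at h

theorem srcs_sub_verts {u v x : V} (p : Γ.Walk u v) (h : x ∈ p.srcs) : x ∈ p.verts := by
  rw [verts_eq]; simp [h]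

theorem split_srcs {u v x : V} (W : Γ.Walk u v) (h : x ∈ W.srcs) :
    ∃ (A : Γ.Walk u x) (B : Γ.Walk x v), W = A.append B ∧ 0 < B.len := by
  induction W with
  | nil v => simp at h
  | cons e d p ih =>
    by_cases hx : x = Γ.endpt e d
    · subst hx
      exact ⟨.nil _, .cons e d p, rfl, by simp⟩
    · simp [hx] at h
      obtain ⟨A, B, rfl, hB⟩ := ih h
      exact ⟨.cons e d A, B, rfl, hB⟩

theorem split_verts {u v x : V} (W : Γ.Walk u v) (h : x ∈ W.verts) :
    ∃ (A : Γ.Walk u x) (B : Γ.Walk x v), W = A.append B := by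
  rw [verts_eq] at h
  simp at h
  rcases h with h | rfl
  · obtain ⟨A, B, h, _⟩ := split_srcs W h
    exact ⟨A, B, h⟩
  · exact ⟨W, .nil _, by simp⟩

/-- Either a walk is a path or it contains a closed subwalk without repeated vertices. -/
theorem exists_closed {u v : V} (W : Γ.Walk u v) :
    W.verts.Nodup ∨ ∃ (x : V) (A : Γ.Walk u x) (B : Γ.Walk x x) (C : Γ.Walk x v),
      W = A.append (B.append C) ∧ 0 < B.len ∧ B.srcs.Nodup := by
  induction W with
  | nil v => left; simp [verts]
  | cons e d p ih =>
    rcases ih with ih | ⟨x, A, B, C, rfl, hB, hn⟩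
    · by_cases hx : Γ.endpt e d ∈ p.verts
      · right
        obtain ⟨A, B, rfl⟩ := split_verts p hx
        refine ⟨_, .nil _, .cons e d A, B, rfl, by simp, ?_⟩
        simp only [srcs_cons]
        rw [verts_eq, srcs_append] at ih
        have hn := (List.nodup_append.1 ih).1
        rw [List.nodup_append] at hn
        rw [List.nodup_cons]
        refine ⟨?_, hn.1⟩
        intro hA
        rw [List.append_assoc, ← verts_eq, List.nodup_append] at ih
        refine ih.2.2 _ hA (Γ.endpt e d) ?_ rfl
        exact start_mem_verts B
      · left
        simp only [verts]
        exact List.nodup_cons.2 ⟨hx, ih⟩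
    · right
      exact ⟨x, .cons e d A, B, C, rfl, hB, hn⟩

theorem exists_closed_of_closed {u : V} (W : Γ.Walk u u) (h : 0 < W.len) :
    ∃ (x : V) (A : Γ.Walk u x) (B : Γ.Walk x x) (C : Γ.Walk x u),
      W = A.append (B.append C) ∧ 0 < B.len ∧ B.srcs.Nodup := by
  rcases exists_closed W with h1 | h1
  · exfalso
    rw [verts_eq, List.nodup_append] at h1
    exact h1.2.2 u (src_mem W h) u (by simp) rfl
  · exact h1

theorem split_edge {u v : V} {e : E} (W : Γ.Walk u v) (h : e ∈ W.edges) :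
    ∃ (d : Bool) (A : Γ.Walk u (Γ.endpt e d)) (B : Γ.Walk (Γ.endpt e (!d)) v),
      W = A.append (.cons e d B) := by
  induction W with
  | nil v => simp [edges] at h
  | cons e' d p ih =>
    by_cases hx : e = e'
    · subst hx
      exact ⟨d, .nil _, p, rfl⟩
    · simp [hx, edges] at h
      obtain ⟨d', A, B, rfl⟩ := ih h
      exact ⟨d', .cons e' d A, B, rfl⟩

theorem endpt_mem_verts {u v : V} {e : E} (W : Γ.Walk u v) (h : e ∈ W.edges) (b : Bool) :
    Γ.endpt e b ∈ W.verts := by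
  obtain ⟨d, A, B, rfl⟩ := split_edge W h
  rw [verts_eq, srcs_append, srcs_cons]
  have h1 := start_mem_verts B
  rw [verts_eq] at h1
  by_cases hb : b = d
  · subst hb; simp
  · have : b = !d := by cases b <;> cases d <;> simp_all
    subst this
    simp at h1 ⊢
    tauto

theorem mem_srcs_of_verts {u x : V} (W : Γ.Walk u u) (h : 0 < W.len) (hx : x ∈ W.verts) :
    x ∈ W.srcs := by
  rw [verts_eq] at hx
  simp at hx
  rcases hx with h1 | rfl
  · exact h1
  · exact src_mem W h

theorem len_pos_of_mem {u v : V} {e : E} (W : Γ.Walk u v) (h : e ∈ W.edges) : 0 < W.len :=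
  List.length_pos_of_mem h

theorem not_loop_of_path {u v : V} {e : E} (W : Γ.Walk u v) (hn : W.verts.Nodup)
    (h : e ∈ W.edges) : Γ.endpt e true ≠ Γ.endpt e false := by
  obtain ⟨d, A, B, rfl⟩ := split_edge W h
  rw [verts_eq, srcs_append, srcs_cons, List.append_assoc, List.cons_append, ← verts_eq] at hn
  have h1 := (List.nodup_cons.1 (List.nodup_append.1 hn).2.1).1
  intro h2
  apply h1
  have h3 := start_mem_verts B
  cases d <;> simp_all

theorem loop_of_cycle {u : V} {e : E} (W : Γ.Walk u u) (hn : W.srcs.Nodup)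
    (h : e ∈ W.edges) (hl : Γ.endpt e true = Γ.endpt e false) :
    W.edges = [e] := by
  obtain ⟨d, A, B, hW⟩ := split_edge W h
  have hl' : Γ.endpt e (!d) = Γ.endpt e d := by cases d <;> simp_all
  have hs : W.srcs = A.srcs ++ Γ.endpt e d :: B.srcs := by rw [hW]; simp
  rw [hs, List.nodup_append, List.nodup_cons] at hn
  have hB : B.len = 0 := by
    by_contra hB
    exact hn.2.1.1 (src_mem_of_eq B (by omega) hl')
  have hu : Γ.endpt e (!d) = u := eq_of_len B hB
  have hA : A.len = 0 := by
    by_contra hA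
    have := src_mem A (by omega)
    refine hn.2.2 _ this (Γ.endpt e d) (by simp) ?_
    rw [← hu, hl']
  rw [hW]
  simp only [len, List.length_eq_zero_iff] at hA hB
  simp [hA, hB, edges]

theorem dup_edge {u v : V} (W : Γ.Walk u v) (h : ¬ W.edges.Nodup) :
    ∃ (e : E) (d : Bool) (A : Γ.Walk u (Γ.endpt e d)) (B : Γ.Walk (Γ.endpt e (!d)) v),
      W = A.append (.cons e d B) ∧ e ∈ B.edges := by
  induction W with
  | nil v => simp [edges] at h
  | cons e d p ih =>
    by_cases hx : e ∈ p.edges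
    · exact ⟨e, d, .nil _, p, rfl, hx⟩
    · simp only [edges, List.nodup_cons, not_and] at h
      obtain ⟨e', d', A, B, rfl, hB⟩ := ih (h hx)
      exact ⟨e', d', .cons e d A, B, rfl, hB⟩

/-- A closed walk without repeated vertices has no repeated edges or is `e e⁻¹`. -/
theorem edges_nodup_or {u : V} (W : Γ.Walk u u) (hn : W.srcs.Nodup) :
    W.edges.Nodup ∨ ∃ (e : E) (d : Bool), W.steps = [(e, d), (e, !d)] := by
  by_cases hE : W.edges.Nodup
  · exact Or.inl hE
  right
  obtain ⟨e, d, A, B, hW, hB⟩ := dup_edge W hE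
  obtain ⟨d', C, D, hB'⟩ := split_edge B hB
  have hs : W.srcs = A.srcs ++ Γ.endpt e d :: (C.srcs ++ Γ.endpt e d' :: D.srcs) := by
    rw [hW, hB']; simp
  rw [hs, List.nodup_append, List.nodup_cons, List.nodup_append, List.nodup_cons] at hn
  obtain ⟨hn1, ⟨hn2, hn3, ⟨hn4, hn5⟩, hn6⟩, hn7⟩ := hn
  have hd : d' = !d := by
    by_contra hd
    have : d' = d := by cases d <;> cases d' <;> simp_all
    subst this
    simp at hn2
  have hC : C.len = 0 := by
    by_contra hC
    refine hn6 _ (src_mem_of_eq C (by omega) rfl) (Γ.endpt e d') (by simp) (by rw [hd])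
  have hdd : (!d') = d := by simp [hd]
  have hD : D.len = 0 := by
    by_contra hD
    apply hn2
    have := src_mem_of_eq D (x := Γ.endpt e d) (by omega) (by rw [hdd])
    simp [this]
  have hu := eq_of_len D hD
  rw [hdd] at hu
  have hA : A.len = 0 := by
    by_contra hA
    exact hn7 _ (src_mem A (by omega)) (Γ.endpt e d) (by simp) hu.symm
  refine ⟨e, d, ?_⟩
  rw [hW, hB']
  simp [steps, steps_of_len A hA, steps_of_len C hC, steps_of_len D hD, hd]

end Walk

end Walks

end SGraph

namespace SGraph

section Tension

variable {V E : Type} {Γ : SGraph V E} {G : Type} [AddCommGroup G]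
variable {ω : E → Bool → ℤˣ} {f : E → G}

open Walk

theorem tS_append {u v w : V} (p : Γ.Walk u v) (q : Γ.Walk v w) :
    (p.append q).tensionSum ω f = p.tensionSum ω f + (p.sgn : ℤ) • q.tensionSum ω f := by
  induction p with
  | nil v => simp [append, tensionSum, sgn]
  | cons e d p ih => simp [append, tensionSum, sgn, ih, mul_smul, smul_add, add_assoc]

theorem tS_rev (hω : Γ.IsCompatible ω) {u v : V} (p : Γ.Walk u v) :
    p.tensionSum ω f + (p.sgn : ℤ) • p.rev.tensionSum ω f = 0 := by
  induction p with
  | nil v => simp [rev, tensionSum]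
  | cons e d p ih =>
    simp only [rev, tS_append, tensionSum, sgn, sgn_rev]
    have h1 : (revStep Γ e d).tensionSum ω f = (ω e (!d) : ℤ) • f e := by
      cases d <;> simp [revStep, tensionSum]
    have h2 : (ω e d : ℤ) • f e + (Γ.sign e : ℤ) • (ω e (!d) : ℤ) • f e = 0 := by
      rw [hω e]
      rcases Int.units_eq_one_or (ω e true) with h | h <;>
      rcases Int.units_eq_one_or (ω e false) with h' | h' <;> cases d <;> simp [h, h']
    rw [h1]
    rcases Int.units_eq_one_or (Γ.sign e) with h | h <;>
    rcases Int.units_eq_one_or p.sgn with h' | h' <;> simp [h, h'] at h2 ih ⊢ <;> grind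

theorem tS_rot {u v : V} (A : Γ.Walk u v) (B : Γ.Walk v u) (hs : A.sgn * B.sgn = 1)
    (h : (B.append A).tensionSum ω f = 0) : (A.append B).tensionSum ω f = 0 := by
  rw [tS_append] at h ⊢
  rcases Int.units_eq_one_or A.sgn with h1 | h1 <;>
  rcases Int.units_eq_one_or B.sgn with h2 | h2 <;> simp [h1, h2] at h hs ⊢ <;> grind

/-- All shorter positive closed walks have zero sum. -/
def Short (Γ : SGraph V E) (ω : E → Bool → ℤˣ) (f : E → G) (n : ℕ) : Prop :=
  ∀ (v : V) (W : Γ.Walk v v), W.len < n → W.sgn = 1 → W.tensionSum ω f = 0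

theorem three {n : ℕ} (ih : Short Γ ω f n) {v : V} (X Y Z : Γ.Walk v v)
    (hX : 0 < X.len) (hY : 0 < Y.len) (hZ : 0 < Z.len) (hl : X.len + Y.len + Z.len ≤ n)
    (hs : X.sgn * Y.sgn * Z.sgn = 1) : 
    (X.append (Y.append Z)).tensionSum ω f = 0 := by
  have a1 := ih v X (by omega)
  have a2 := ih v Y (by omega)
  have a3 := ih v Z (by omega)
  have b1 := ih v (Y.append Z) (by simp; omega)
  have b2 := ih v (X.append Z) (by simp; omega)
  have b3 := ih v (X.append Y) (by simp; omega)
  simp only [sgn_append, tS_append] at *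
  rcases Int.units_eq_one_or X.sgn with h1 | h1 <;>
  rcases Int.units_eq_one_or Y.sgn with h2 | h2 <;>
  rcases Int.units_eq_one_or Z.sgn with h3 | h3 <;>
  simp [h1, h2, h3] at * <;> grind

theorem four (hω : Γ.IsCompatible ω) {n : ℕ} (ih : Short Γ ω f n) {v x : V}
    (A : Γ.Walk v x) (B : Γ.Walk x v) (C : Γ.Walk v x) (D : Γ.Walk x v)
    (h1 : 0 < A.len + B.len) (h2 : 0 < C.len + D.len) (h3 : 0 < B.len + C.len)
    (h4 : 0 < A.len + D.len) (h5 : 0 < A.len + C.len) (h6 : 0 < B.len + D.len)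
    (hl : A.len + B.len + C.len + D.len ≤ n)
    (hs : A.sgn * B.sgn * C.sgn * D.sgn = 1) : 
    (A.append (B.append (C.append D))).tensionSum ω f = 0 := by
  have a1 := ih v (A.append B) (by simp; omega)
  have a2 := ih v (C.append D) (by simp; omega)
  have b1 := ih x (B.append C) (by simp; omega)
  have b2 := ih x (D.append A) (by simp; omega)
  have c1 := ih v (A.append C.rev) (by simp; omega)
  have c2 := ih x (B.append D.rev) (by simp; omega)
  have rC := tS_rev (f := f) hω C
  have rD := tS_rev (f := f) hω D
  simp only [sgn_append, tS_append, sgn_rev] at *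
  rcases Int.units_eq_one_or A.sgn with h1 | h1 <;>
  rcases Int.units_eq_one_or B.sgn with h2 | h2 <;>
  rcases Int.units_eq_one_or C.sgn with h3 | h3 <;>
  rcases Int.units_eq_one_or D.sgn with h4 | h4 <;>
  simp [h1, h2, h3, h4] at * <;> grind

theorem cycle_of_neg {v : V} (C : Γ.Walk v v) (hl : 0 < C.len) (hn : C.srcs.Nodup)
    (hs : C.sgn = -1) : Γ.IsUnbalancedCycle C := by
  refine ⟨⟨edges_ne_nil C hl, hn, ?_⟩, hs⟩
  rcases edges_nodup_or C hn with h | ⟨e, d, h⟩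
  · exact h
  · rw [sgn_eq_steps, h] at hs
    simp at hs

theorem tS_eq_steps {u v : V} (p : Γ.Walk u v) :
    p.tensionSum ω f = (p.steps.foldr (fun s t => ((ω s.1 s.2 : ℤ) • f s.1) +
      ((Γ.sign s.1 : ℤ) • t)) 0) := by
  induction p with
  | nil v => rfl
  | cons e d p ih => simp [tensionSum, steps, ih]

theorem circ_of_basic (hf : Γ.IsTension ω f) {v : V} {W : Γ.Walk v v}
    (h : Γ.IsBasicCircuitWalk W) : W.tensionSum ω f = 0 :=
  hf v W ⟨v, .nil v, W, by simp, h⟩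

theorem tS_two (hω : Γ.IsCompatible ω) (e : E) (d : Bool) :
    (ω e d : ℤ) • f e + (Γ.sign e : ℤ) • (ω e (!d) : ℤ) • f e = 0 := by
  rw [hω e]
  rcases Int.units_eq_one_or (ω e true) with h | h <;>
  rcases Int.units_eq_one_or (ω e false) with h' | h' <;> cases d <;> simp [h, h']

theorem pos_cycle (hω : Γ.IsCompatible ω) (hf : Γ.IsTension ω f) {v : V} (C : Γ.Walk v v)
    (hl : 0 < C.len) (hn : C.srcs.Nodup) (hs : C.sgn = 1) : C.tensionSum ω f = 0 := by
  rcases edges_nodup_or C hn with h | ⟨e, d, h⟩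
  · exact circ_of_basic hf (Or.inl ⟨⟨edges_ne_nil C hl, hn, h⟩, hs⟩)
  · rw [tS_eq_steps, h]
    simpa using tS_two hω e d

theorem steps_of_edges_singleton {u v : V} {e : E} (p : Γ.Walk u v) (h : p.edges = [e]) :
    ∃ d, p.steps = [(e, d)] := by
  cases p with
  | nil => simp [edges] at h
  | cons e' d p => 
    simp [edges] at h
    refine ⟨d, ?_⟩
    rw [steps, steps_of_len p (by simp [len, h.2]), h.1]

theorem tight (hω : Γ.IsCompatible ω) (hf : Γ.IsTension ω f) {n : ℕ} (ih : Short Γ ω f n)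
    {v : V} (C D : Γ.Walk v v) (hC : 0 < C.len) (hD : 0 < D.len)
    (hCn : C.srcs.Nodup) (hDn : D.srcs.Nodup) (hCs : C.sgn = -1) (hDs : D.sgn = -1)
    (hl : C.len + D.len ≤ n) : (C.append D).tensionSum ω f = 0 := by
  by_cases hx : ∃ x ∈ C.srcs, x ∈ D.srcs ∧ x ≠ v
  · obtain ⟨x, h1, h2, h3⟩ := hx
    obtain ⟨A, B, rfl, hB⟩ := split_srcs C h1
    obtain ⟨A', B', rfl, hB'⟩ := split_srcs D h2
    have := len_pos_of_ne A (Ne.symm h3)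
    have := len_pos_of_ne A' (Ne.symm h3)
    rw [append_assoc]
    simp at hl hCs hDs
    apply four hω ih <;> try omega
    rw [mul_assoc (A.sgn * B.sgn), hCs, hDs]; simp
  push Not at hx
  by_cases he : ∃ e ∈ C.edges, e ∈ D.edges
  · obtain ⟨e, h1, h2⟩ := he
    have h3 : ∀ b, Γ.endpt e b = v := fun b => hx _
      (mem_srcs_of_verts C hC (endpt_mem_verts C h1 b))
      (mem_srcs_of_verts D hD (endpt_mem_verts D h2 b))
    have h4 := loop_of_cycle C hCn h1 (by rw [h3, h3])
    have h5 := loop_of_cycle D hDn h2 (by rw [h3, h3])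
    obtain ⟨d, h6⟩ := steps_of_edges_singleton C h4
    obtain ⟨d', h7⟩ := steps_of_edges_singleton D h5
    have hσ : Γ.sign e = -1 := by
      rw [sgn_eq_steps, h6] at hCs
      simpa using hCs
    have h8 := hω e
    rw [tS_eq_steps, steps_append, h6, h7]
    rw [hσ] at h8
    rcases Int.units_eq_one_or (ω e true) with h | h <;>
    rcases Int.units_eq_one_or (ω e false) with h' | h' <;> cases d <;> cases d' <;>
      simp [h, h', hσ] at h8 ⊢
  push Not at he
  refine circ_of_basic hf (Or.inr (Or.inl ⟨C, D, ⟨cycle_of_neg C hC hCn hCs,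
    cycle_of_neg D hD hDn hDs, hx, he⟩, rfl⟩))

theorem loose (hω : Γ.IsCompatible ω) (hf : Γ.IsTension ω f) {n : ℕ} (ih : Short Γ ω f n)
    {v y : V} (C : Γ.Walk v v) (A : Γ.Walk v y) (D : Γ.Walk y y) (hC : 0 < C.len)
    (hD : 0 < D.len) (hA : 0 < A.len)
    (hCn : C.srcs.Nodup) (hDn : D.srcs.Nodup) (hCs : C.sgn = -1) (hDs : D.sgn = -1)
    (hl : C.len + D.len + 2 * A.len ≤ n) :
    (C.append (A.append (D.append A.rev))).tensionSum ω f = 0 := by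
  have sq : ∀ a : ℤˣ, a * a = 1 := Int.units_mul_self
  rcases exists_closed A with hAn | ⟨z, A1, B, A2, rfl, hB, -⟩
  swap
  · have := three ih B (A2.append (D.append (A2.rev.append B.rev)))
      (A1.rev.append (C.append A1)) hB (by simp; omega) (by simp; omega)
      (by simp at hl ⊢; omega)
      (by
        simp only [sgn_append, sgn_rev, hCs, hDs]
        rcases Int.units_eq_one_or A1.sgn with h1 | h1 <;>
        rcases Int.units_eq_one_or A2.sgn with h2 | h2 <;>
        rcases Int.units_eq_one_or B.sgn with h3 | h3 <;> simp [h1, h2, h3])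
    have h2 := tS_rot (C.append A1) (B.append (A2.append (D.append (A2.rev.append 
      (B.rev.append A1.rev)))))
      (by
        simp only [sgn_append, sgn_rev, hCs, hDs]
        rcases Int.units_eq_one_or A1.sgn with h1 | h1 <;>
        rcases Int.units_eq_one_or A2.sgn with h2 | h2 <;>
        rcases Int.units_eq_one_or B.sgn with h3 | h3 <;> simp [h1, h2, h3])
      (by simpa only [append_assoc] using this)
    simpa only [append_assoc, rev_append] using h2
  by_cases k1 : ∀ z ∈ A.verts, z ∈ C.srcs → z = v
  swap
  · push Not at k1
    obtain ⟨z, hz1, hz2, hzv⟩ := k1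
    obtain ⟨A1, A2, rfl⟩ := split_verts A hz1
    obtain ⟨P, Q, rfl, hQ⟩ := split_srcs C hz2
    have := len_pos_of_ne P (Ne.symm hzv)
    simp only [sgn_append] at hCs
    have hh := three ih (Q.append A1) (A2.append (D.append A2.rev))
      (A1.rev.append P) (by simp; omega) (by simp; omega) (by simp; omega)
      (by simp at hl ⊢; omega)
      (by
        simp only [sgn_append, sgn_rev, hDs]
        rcases Int.units_eq_one_or A1.sgn with h1 | h1 <;>
        rcases Int.units_eq_one_or A2.sgn with h2 | h2 <;>
        rcases Int.units_eq_one_or P.sgn with h3 | h3 <;>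
        rcases Int.units_eq_one_or Q.sgn with h4 | h4 <;> simp [h1, h2, h3, h4] at hCs ⊢)
    have h2 := tS_rot P (Q.append (A1.append (A2.append (D.append (A2.rev.append A1.rev)))))
      (by
        simp only [sgn_append, sgn_rev, hDs]
        rcases Int.units_eq_one_or A1.sgn with h1 | h1 <;>
        rcases Int.units_eq_one_or A2.sgn with h2 | h2 <;>
        rcases Int.units_eq_one_or P.sgn with h3 | h3 <;>
        rcases Int.units_eq_one_or Q.sgn with h4 | h4 <;> simp [h1, h2, h3, h4] at hCs ⊢)
      (by simpa only [append_assoc] using hh)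
    simpa only [append_assoc, rev_append] using h2
  by_cases k2 : ∀ z ∈ A.verts, z ∈ D.srcs → z = y
  swap
  · push Not at k2
    obtain ⟨z, hz1, hz2, hzv⟩ := k2
    obtain ⟨A1, A2, rfl⟩ := split_verts A hz1
    obtain ⟨P, Q, rfl, hQ⟩ := split_srcs D hz2
    have := len_pos_of_ne P (Ne.symm hzv)
    simp only [sgn_append] at hDs
    have hh := three ih (A2.append P) (Q.append A2.rev)
      (A1.rev.append (C.append A1)) (by simp; omega) (by simp; omega) (by simp; omega)
      (by simp at hl ⊢; omega)
      (by
        simp only [sgn_append, sgn_rev, hCs]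
        rcases Int.units_eq_one_or A1.sgn with h1 | h1 <;>
        rcases Int.units_eq_one_or A2.sgn with h2 | h2 <;>
        rcases Int.units_eq_one_or P.sgn with h3 | h3 <;>
        rcases Int.units_eq_one_or Q.sgn with h4 | h4 <;> simp [h1, h2, h3, h4] at hDs ⊢)
    have h2 := tS_rot (C.append A1) (A2.append (P.append (Q.append (A2.rev.append A1.rev))))
      (by
        simp only [sgn_append, sgn_rev, hCs]
        rcases Int.units_eq_one_or A1.sgn with h1 | h1 <;>
        rcases Int.units_eq_one_or A2.sgn with h2 | h2 <;>
        rcases Int.units_eq_one_or P.sgn with h3 | h3 <;>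
        rcases Int.units_eq_one_or Q.sgn with h4 | h4 <;> simp [h1, h2, h3, h4] at hDs ⊢)
      (by simpa only [append_assoc] using hh)
    simpa only [append_assoc, rev_append] using h2
  have hvy : v ≠ y := by
    rintro rfl
    rw [verts_eq, List.nodup_append] at hAn
    exact hAn.2.2 v (src_mem A hA) v (by simp) rfl
  by_cases k3 : ∀ z ∈ C.srcs, z ∉ D.srcs
  swap
  · push Not at k3
    obtain ⟨z, hz1, hz2⟩ := k3
    obtain ⟨P, Q, rfl, hQ⟩ := split_srcs C hz1
    obtain ⟨R, S, rfl, hS⟩ := split_srcs D hz2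
    simp only [sgn_append] at hCs hDs
    have hh := four hω ih P Q (A.append R) (S.append A.rev) (by omega) (by simp; omega)
      (by omega) (by simp; omega) (by simp; omega) (by omega)
      (by simp at hl ⊢; omega)
      (by
        simp only [sgn_append, sgn_rev]
        rcases Int.units_eq_one_or A.sgn with h1 | h1 <;>
        rcases Int.units_eq_one_or R.sgn with h2 | h2 <;>
        rcases Int.units_eq_one_or P.sgn with h3 | h3 <;>
        rcases Int.units_eq_one_or S.sgn with h5 | h5 <;>
        rcases Int.units_eq_one_or Q.sgn with h4 | h4 <;> simp [h1, h2, h3, h4, h5] at hDs hCs ⊢)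
    simpa only [append_assoc] using hh
  have k4 : ∀ e ∈ A.edges, e ∉ C.edges ∧ e ∉ D.edges := by
    intro e he
    have hnl := not_loop_of_path A hAn he
    constructor
    · intro h
      apply hnl
      rw [k1 _ (endpt_mem_verts A he true) (mem_srcs_of_verts C hC (endpt_mem_verts C h true)),
        k1 _ (endpt_mem_verts A he false) (mem_srcs_of_verts C hC (endpt_mem_verts C h false))]
    · intro h
      apply hnl
      rw [k2 _ (endpt_mem_verts A he true) (mem_srcs_of_verts D hD (endpt_mem_verts D h true)),
        k2 _ (endpt_mem_verts A he false) (mem_srcs_of_verts D hD (endpt_mem_verts D h false))]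
  exact circ_of_basic hf (Or.inr (Or.inr ⟨y, C, A, D, A.rev, ⟨cycle_of_neg C hC hCn hCs,
    cycle_of_neg D hD hDn hDs, ⟨edges_ne_nil A hA, hAn⟩, k3, k1, k2, k4⟩,
    rev_isReverseOf A, rfl⟩))

theorem pos_closed (hω : Γ.IsCompatible ω) (hf : Γ.IsTension ω f) (n : ℕ) :
    Short Γ ω f n := by
  induction n with
  | zero => intro v W h; omega
  | succ n IH =>
  intro a W hlen hs
  have ih : Short Γ ω f W.len := fun v W' h => IH v W' (by omega)
  clear hlen IH
  rcases Nat.eq_zero_or_pos W.len with h0 | h0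
  · rw [eq_nil_of_len W h0]; rfl
  obtain ⟨x, A, C, B, rfl, hC, hCn⟩ := exists_closed_of_closed W h0
  clear h0
  apply tS_rot
  · simpa [mul_assoc] using hs
  have key : ∀ W2 : Γ.Walk x x, C.len + W2.len ≤ (A.append (C.append B)).len →
      C.sgn * W2.sgn = 1 → (C.append W2).tensionSum ω f = 0 := by
    generalize (A.append (C.append B)).len = n at ih
    clear hs
    intro W2 hl hs
    rcases Nat.eq_zero_or_pos W2.len with h0 | h0
    · rw [eq_nil_of_len W2 h0]
      rw [eq_nil_of_len W2 h0] at hs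
      rw [append_nil]
      exact pos_cycle hω hf C hC hCn (by simpa [sgn] using hs)
    rcases Int.units_eq_one_or C.sgn with hCs | hCs
    · have h1 : W2.sgn = 1 := by simpa [hCs] using hs
      rw [tS_append, ih x C (by omega) hCs, ih x W2 (by omega) h1]; simp
    have hWs : W2.sgn = -1 := by
      rw [hCs] at hs
      rcases Int.units_eq_one_or W2.sgn with h | h
      · simp [h] at hs
      · exact h
    obtain ⟨y, P, D, Q, rfl, hD, hDn⟩ := exists_closed_of_closed W2 h0
    simp only [len_append, sgn_append] at hl hWs
    rcases Int.units_eq_one_or D.sgn with hDs | hDs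
    · have h1 := ih y D (by omega) hDs
      have h2 := ih x (C.append (P.append Q)) (by simp; omega)
        (by simp [hDs] at hWs; simp [hWs, hCs])
      simp only [tS_append, sgn_append, hDs, hCs, h1] at h2 ⊢
      simpa using h2
    have hPQ : P.sgn = Q.sgn := by
      rcases Int.units_eq_one_or P.sgn with h | h <;>
      rcases Int.units_eq_one_or Q.sgn with h' | h' <;> simp [h, h', hDs] at hWs ⊢
    have hPQ0 := ih x (P.append Q) (by simp; omega) (by simp [hPQ])
    by_cases hP : P.len = 0
    · have hxy := eq_of_len P hP
      subst hxy
      rw [eq_nil_of_len P hP] at hPQ ⊢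
      simp only [sgn] at hPQ
      rw [nil_append]
      by_cases hQ : Q.len = 0
      · rw [eq_nil_of_len Q hQ, append_nil]
        exact tight hω hf ih C D hC hD hCn hDn hCs hDs (by omega)
      · exact three ih C D Q hC hD (by omega) (by omega) (by simp [hCs, hDs, ← hPQ])
    by_cases hQ : Q.len = 0
    · have hxy := eq_of_len Q hQ
      subst hxy
      rw [eq_nil_of_len Q hQ] at hPQ ⊢
      simp only [sgn] at hPQ
      rw [append_nil]
      exact three ih C P D hC (by omega) hD (by omega) (by simp [hCs, hDs, hPQ])
    have hPr := tS_rev (f := f) hω P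
    have hQr := tS_rev (f := f) hω Q
    by_cases hPQl : P.len ≤ Q.len
    · have := loose hω hf ih C P D hC hD (by omega) hCn hDn hCs hDs (by omega)
      simp only [tS_append, sgn_append, hCs, hDs] at this hPQ0 ⊢
      rcases Int.units_eq_one_or P.sgn with h | h <;> simp [h] at this hPQ0 hPr ⊢ <;> grind
    · have := loose hω hf ih C Q.rev D hC hD (by simp; omega) hCn hDn hCs hDs (by simp; omega)
      have hQrr := tS_rev (f := f) hω Q.rev
      simp only [tS_append, sgn_append, hCs, hDs, sgn_rev, ← hPQ] at this hPQ0 hQr hQrr ⊢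
      rcases Int.units_eq_one_or P.sgn with h | h <;> simp [h] at this hPQ0 hQr hQrr ⊢ <;> grind
  have := key (B.append A) (by simp; omega) (by
    simp only [sgn_append] at hs ⊢; rw [← hs]; 
    rw [mul_comm A.sgn, mul_assoc])
  rw [← append_assoc] at this
  exact this

theorem tS_pos (hω : Γ.IsCompatible ω) (hf : Γ.IsTension ω f) {v : V} (W : Γ.Walk v v)
    (hs : W.sgn = 1) : W.tensionSum ω f = 0 :=
  pos_closed hω hf (W.len + 1) v W (by omega) hs

end Tension

end SGraph

attribute [local instance] Classical.propDecidable

namespace SGraph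

section Colorings

variable {V E : Type} {Γ : SGraph V E} {G : Type} [AddCommGroup G]
variable {ω : E → Bool → ℤˣ} {f : E → G}

open Walk

theorem comp_endpt (e : E) (d : Bool) : Γ.comp (Γ.endpt e d) = Γ.comp (Γ.endpt e (!d)) := by
  apply Quot.sound
  refine ⟨e, ?_⟩
  cases d <;> simp [endpt]

theorem Walk.comp_eq {v w : V} (W : Γ.Walk v w) : Γ.comp v = Γ.comp w := by
  induction W with
  | nil v => rfl
  | cons e d p ih => rw [comp_endpt, ih]

theorem walk_of_adj {v w : V} (h : Γ.Adj v w) : Nonempty (Γ.Walk v w) := by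
  obtain ⟨e, h | h⟩ := h
  · have := (Walk.cons e true (.nil _) : Γ.Walk (Γ.endpt e true) (Γ.endpt e (!true)))
    simp [endpt, h] at this
    exact ⟨this⟩
  · have := (Walk.cons e false (.nil _) : Γ.Walk (Γ.endpt e false) (Γ.endpt e (!false)))
    simp [endpt, h] at this
    exact ⟨this⟩

theorem walk_of_comp {v w : V} (h : Γ.comp v = Γ.comp w) : Nonempty (Γ.Walk v w) := by
  have := Quot.eqvGen_exact h
  induction this with
  | rel x y ha => exact walk_of_adj ha
  | refl x => exact ⟨.nil x⟩
  | symm x y _ ih => obtain ⟨W⟩ := ih (Quot.eqvGen_sound ‹_›); exact ⟨W.rev⟩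
  | trans x y z h1 h2 ih1 ih2 =>
    obtain ⟨W⟩ := ih1 (Quot.eqvGen_sound h1)
    obtain ⟨W'⟩ := ih2 (Quot.eqvGen_sound h2)
    exact ⟨W.append W'⟩

/-- A negative closed walk yields an unbalanced cycle in the same component. -/
theorem exists_cycle_of_neg (n : ℕ) : ∀ {v : V} (W : Γ.Walk v v), W.len ≤ n → W.sgn = -1 →
    ∃ (x : V) (_ : Γ.Walk v x) (C : Γ.Walk x x), Γ.IsUnbalancedCycle C := by
  induction n with
  | zero => 
    intro v W h hs
    rw [eq_nil_of_len W (by omega)] at hs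
    simp [sgn] at hs
  | succ n ih =>
    intro v W h hs
    have hl : 0 < W.len := by
      by_contra h0
      rw [eq_nil_of_len W (by omega)] at hs
      simp [sgn] at hs
    obtain ⟨x, A, B, C, rfl, hB, hn⟩ := exists_closed_of_closed W hl
    rcases Int.units_eq_one_or B.sgn with h1 | h1
    · refine ih (A.append C) ?_ ?_
      · simp at h ⊢; omega
      · simpa [h1] using hs
    · exact ⟨x, A, B, cycle_of_neg B hB hn h1⟩

theorem unbal_iff {v : V} : ¬ Γ.IsBalancedComponent (Γ.comp v) ↔ ∃ W : Γ.Walk v v, W.sgn = -1 := by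
  constructor
  · intro h
    unfold IsBalancedComponent at h
    push Not at h
    obtain ⟨x, hx, W, _, hW⟩ := h
    obtain ⟨P⟩ := walk_of_comp hx
    refine ⟨P.rev.append (W.append P), ?_⟩
    have h1 := (Int.units_eq_one_or W.sgn).resolve_left hW
    simp only [sgn_append, sgn_rev, h1]
    rcases Int.units_eq_one_or P.sgn with h1 | h1 <;> simp [h1]
  · rintro ⟨W, hW⟩ hb
    obtain ⟨x, P, C, hC⟩ := exists_cycle_of_neg W.len W le_rfl hW
    have := hb x P.comp_eq.symm C hC.1
    rw [hC.2] at this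
    simp at this

/-- The twisted action of signs on `G`: `-1` acts as `x ↦ -x-u`. -/
def act (u : G) (s : ℤˣ) (x : G) : G := if s = 1 then x else -x - u

@[simp] theorem act_one (u x : G) : act u 1 x = x := by simp [act]
@[simp] theorem act_neg_one (u x : G) : act u (-1) x = -x - u := by simp [act]
theorem act_mul (u : G) (s t : ℤˣ) (x : G) : act u (s * t) x = act u s (act u t x) := by
  rcases Int.units_eq_one_or s with rfl | rfl <;> rcases Int.units_eq_one_or t with rfl | rfl <;>
    simp

theorem act_add (u : G) (s : ℤˣ) (x y : G) : act u s (x + y) = (s : ℤ) • x + act u s y := by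
  rcases Int.units_eq_one_or s with rfl | rfl <;> simp
  abel

/-- Sign-compatible vertex labelings. -/
def Col (Γ : SGraph V E) (u : G) : Type :=
  {g : V → G // ∀ e, g (Γ.ends e).1 = act u (Γ.sign e) (g (Γ.ends e).2)}

theorem col_step {u : G} (g : Γ.Col u) (e : E) (d : Bool) :
    g.1 (Γ.endpt e d) = act u (Γ.sign e) (g.1 (Γ.endpt e (!d))) := by
  have := g.2 e
  cases d
  · simp only [endpt, Bool.not_false, cond_true, cond_false]
    rw [this, ← act_mul]; simp
  · exact this

theorem col_walk {u : G} (g : Γ.Col u) {v w : V} (W : Γ.Walk v w) :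
    g.1 v = act u W.sgn (g.1 w) := by
  induction W with
  | nil v => simp [sgn]
  | cons e d p ih => rw [col_step, ih, sgn, act_mul]

/-- Root of a component. -/
noncomputable def root (c : Γ.Components) : V := Quot.out c

theorem comp_root (c : Γ.Components) : Γ.comp (root c) = c := Quot.out_eq c

/-- A walk to the root. -/
noncomputable def toRoot (Γ : SGraph V E) (v : V) : Γ.Walk v (root (Γ.comp v)) :=
  (walk_of_comp (comp_root (Γ.comp v)).symm).some

/-- Labelings correspond to choices at the roots. -/
noncomputable def colEquiv (Γ : SGraph V E) (u : G) :
    Γ.Col u ≃ ∀ c : Γ.Components, {x : G // ¬ Γ.IsBalancedComponent c → act u (-1) x = x} where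
  toFun g c := ⟨g.1 (root c), by
    intro h
    rw [← comp_root c, unbal_iff] at h
    obtain ⟨W, hW⟩ := h
    have := col_walk g W
    rw [hW] at this
    exact this.symm⟩
  invFun h := ⟨fun v => act u (toRoot Γ v).sgn (h (Γ.comp v)).1, by
    have key : ∀ (v : V) (c : Γ.Components) (_ : Γ.comp v = c) (W : Γ.Walk v (root c)),
        act u (toRoot Γ v).sgn (h (Γ.comp v)).1 = act u W.sgn (h c).1 := by
      rintro v _ rfl W
      by_cases hs : (toRoot Γ v).sgn = W.sgn
      · rw [hs]
      have hu : ¬ Γ.IsBalancedComponent (Γ.comp v) := by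
        rw [← comp_root (Γ.comp v), unbal_iff]
        refine ⟨(toRoot Γ v).rev.append W, ?_⟩
        simp only [sgn_append, sgn_rev]
        rcases Int.units_eq_one_or W.sgn with h1 | h1 <;>
        rcases Int.units_eq_one_or (toRoot Γ v).sgn with h2 | h2 <;> simp [h1, h2] at hs ⊢
      have h3 := (h (Γ.comp v)).2 hu
      rcases Int.units_eq_one_or W.sgn with h1 | h1 <;>
      rcases Int.units_eq_one_or (toRoot Γ v).sgn with h2 | h2 <;> simp only [h1, h2, act_one, h3]
    intro e
    have h1 : Γ.comp (Γ.endpt e true) = Γ.comp (Γ.endpt e false) := comp_endpt e true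
    have := key (Γ.endpt e true) _ h1 (.cons e true (toRoot Γ (Γ.endpt e false)))
    rw [sgn, act_mul] at this
    exact this⟩
  left_inv g := by
    apply Subtype.ext
    funext v
    exact (col_walk g (toRoot Γ v)).symm
  right_inv h := by
    funext c
    apply Subtype.ext
    have : ∀ (c' : Γ.Components) (hc : c' = c) (W : Γ.Walk (root c) (root c')),
        act u W.sgn (h c').1 = (h c).1 := by
      rintro c' rfl W
      rcases Int.units_eq_one_or W.sgn with h1 | h1
      · simp [h1]
      · rw [h1]
        apply (h _).2
        rw [← comp_root c', unbal_iff]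
        exact ⟨W, h1⟩
    exact this _ (comp_root c) _

instance [Finite V] : Finite Γ.Components := inferInstanceAs (Finite (Quot _))

theorem card_col [Finite V] [Finite G] (u : G) : Nat.card (Γ.Col u) =
    Nat.card G ^ Γ.kb * Nat.card {x : G // act u (-1) x = x} ^ Γ.ku := by
  have := Fintype.ofFinite Γ.Components
  rw [Nat.card_congr (colEquiv Γ u), Nat.card_pi]
  have h1 : ∀ c : Γ.Components,
      Nat.card {x : G // ¬ Γ.IsBalancedComponent c → act u (-1) x = x} =
      if Γ.IsBalancedComponent c then Nat.card G else Nat.card {x : G // act u (-1) x = x} := by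
    intro c
    split_ifs with h
    · exact Nat.card_congr ((Equiv.subtypeUnivEquiv (by simp [h])))
    · simp [h]
  simp only [h1]
  rw [Finset.prod_ite]
  simp only [Finset.prod_const, kb, ku, Nat.card_eq_fintype_card, Fintype.card_subtype]

theorem kb_add_ku [Finite V] : Γ.kb + Γ.ku = Γ.kAll := by
  have := Fintype.ofFinite Γ.Components
  simp only [kb, ku, kAll, Nat.card_eq_fintype_card]
  rw [← Fintype.card_sum]; exact Fintype.card_congr (Equiv.sumCompl _)

/-- The affine difference operator. -/
def dl (Γ : SGraph V E) (ω : E → Bool → ℤˣ) (u : G) (g : V → G) (e : E) : G :=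
  (ω e true : ℤ) • g (Γ.ends e).1 + (ω e false : ℤ) • g (Γ.ends e).2 +
    if Γ.sign e = 1 then 0 else (ω e true : ℤ) • u

theorem dl_step (hω : Γ.IsCompatible ω) (u : G) (g : V → G) (e : E) (d : Bool) :
    (ω e d : ℤ) • Γ.dl ω u g e = g (Γ.endpt e d) - act u (Γ.sign e) (g (Γ.endpt e (!d))) := by
  have h := hω e
  simp only [dl, endpt]
  rw [h]
  rcases Int.units_eq_one_or (ω e true) with h1 | h1 <;>
  rcases Int.units_eq_one_or (ω e false) with h2 | h2 <;> cases d <;> simp [h1, h2] <;> abel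

theorem unit_smul_inj (s : ℤˣ) {x y : G} (h : (s : ℤ) • x = (s : ℤ) • y) : x = y := by
  rcases Int.units_eq_one_or s with rfl | rfl <;> simpa using h

theorem dl_eq_zero_iff (hω : Γ.IsCompatible ω) (u : G) (g : V → G) (e : E) :
    Γ.dl ω u g e = 0 ↔ g (Γ.ends e).1 = act u (Γ.sign e) (g (Γ.ends e).2) := by
  have h := dl_step hω u g e true
  constructor
  · intro h0
    rw [h0, smul_zero] at h
    exact sub_eq_zero.1 h.symm
  · intro h0
    apply unit_smul_inj (ω e true)
    rw [h, smul_zero]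
    exact sub_eq_zero.2 h0

theorem tS_dl (hω : Γ.IsCompatible ω) (u : G) (g : V → G) {v w : V} (W : Γ.Walk v w) :
    W.tensionSum ω (Γ.dl ω u g) = g v - act u W.sgn (g w) := by
  induction W with
  | nil v => simp [tensionSum, sgn]
  | @cons e d w p ih =>
    rw [tensionSum, ih, dl_step hω, sgn, act_mul]
    have h := act_add u (Γ.sign e) (g (Γ.endpt e (!d)) - act u p.sgn (g w)) (act u p.sgn (g w))
    rw [sub_add_cancel] at h
    rw [h]
    abel

theorem edgeSum_sub_tS {v w : V} (W : Γ.Walk v w) : W.edgeSum f - W.tensionSum ω f ∈ twoG G := by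
  induction W with
  | nil v => simp [edgeSum, edges, tensionSum, zero_mem]
  | cons e d p ih =>
    obtain ⟨x, hx⟩ := ih
    simp only [doubleHom, AddMonoidHom.mk'_apply] at hx
    have hx' : p.edgeSum f = x + x + p.tensionSum ω f := by rw [hx]; abel
    have h1 : (Walk.cons e d p).edgeSum f = f e + p.edgeSum f := by simp [edgeSum, edges]
    rw [h1, hx', tensionSum]
    rcases Int.units_eq_one_or (ω e d) with h1 | h1 <;>
    rcases Int.units_eq_one_or (Γ.sign e) with h2 | h2 <;> simp only [h1, h2]
    · refine ⟨x, ?_⟩; simp [doubleHom]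
    · refine ⟨x + p.tensionSum ω f, ?_⟩; simp [doubleHom]; abel
    · refine ⟨x + f e, ?_⟩; simp [doubleHom]; abel
    · refine ⟨x + f e + p.tensionSum ω f, ?_⟩; simp [doubleHom]; abel

theorem basic_sgn {v : V} {W : Γ.Walk v v} (h : Γ.IsBasicCircuitWalk W) : W.sgn = 1 := by
  rcases h with h | ⟨C, D, h, rfl⟩ | ⟨w, C, P, D, Q, h, hr, rfl⟩
  · exact h.2
  · simp [h.1.2, h.2.1.2]
  · simp only [sgn_append, h.1.2, h.2.1.2, hr.sgn_eq]
    rcases Int.units_eq_one_or P.sgn with h1 | h1 <;> simp [h1]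

theorem circ_sgn {v : V} {W : Γ.Walk v v} (h : Γ.IsCircuitWalk W) : W.sgn = 1 := by
  obtain ⟨u, A, B, rfl, h⟩ := h
  have := basic_sgn h
  simp only [sgn_append] at this ⊢
  rw [mul_comm, this]

theorem mem_twoG_add (x : G) : x + x ∈ twoG G := ⟨x, rfl⟩

/-- Tensions of class `u`. -/
def IsClass (Γ : SGraph V E) (ω : E → Bool → ℤˣ) (u : G) (f : E → G) : Prop :=
  Γ.IsTension ω f ∧ ∀ (v : V) (W : Γ.Walk v v), Γ.IsUnbalancedCycle W → W.edgeSum f - u ∈ twoG G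

theorem dl_isClass (hω : Γ.IsCompatible ω) (u : G) (g : V → G) : Γ.IsClass ω u (Γ.dl ω u g) := by
  constructor
  · intro v W hW
    rw [tS_dl hω, circ_sgn hW]; simp
  · intro v W hW
    have h1 := edgeSum_sub_tS (ω := ω) (f := Γ.dl ω u g) W
    rw [tS_dl hω, hW.2] at h1
    have h2 := add_mem h1 (mem_twoG_add (g v))
    convert h2 using 1
    simp; abel

theorem class_neg (hω : Γ.IsCompatible ω) (hf : Γ.IsTension ω f) {u : G} {v x : V}
    (P : Γ.Walk v x) (C : Γ.Walk x x) (hC : C.sgn = -1) (hu : C.edgeSum f - u ∈ twoG G)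
    (W : Γ.Walk v v) (hW : W.sgn = -1) : W.edgeSum f - u ∈ twoG G := by
  have h1 := edgeSum_sub_tS (ω := ω) (f := f) W
  have h2 := edgeSum_sub_tS (ω := ω) (f := f) C
  have h3 := tS_pos hω hf (W.append (P.append (C.append P.rev))) (by
    simp only [sgn_append, hW, hC, sgn_rev]
    rcases Int.units_eq_one_or P.sgn with h1 | h1 <;> simp [h1])
  have h4 := tS_rev (f := f) hω P
  simp only [tS_append, hW, hC] at h3
  rcases Int.units_eq_one_or P.sgn with hP | hP <;> simp [hP] at h3 h4
  · have h5 := add_mem (add_mem h1 (sub_mem hu h2)) (mem_twoG_add (P.tensionSum ω f))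
    convert h5 using 1
    grind
  · have h5 := sub_mem (add_mem (add_mem h1 (sub_mem hu h2)) (mem_twoG_add (P.tensionSum ω f)))
      (mem_twoG_add (C.tensionSum ω f))
    convert h5 using 1
    grind

theorem exists_dl (hω : Γ.IsCompatible ω) {u : G} (hf : Γ.IsClass ω u f) :
    ∃ g, Γ.dl ω u g = f := by
  obtain ⟨hf, hu⟩ := hf
  have hx : ∀ c : Γ.Components, ∃ x : G, ∀ W : Γ.Walk (root c) (root c),
      x = W.tensionSum ω f + act u W.sgn x := by
    intro c
    by_cases hc : ∃ W : Γ.Walk (root c) (root c), W.sgn = -1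
    · obtain ⟨W0, h0⟩ := hc
      obtain ⟨y, P, C, hC⟩ := exists_cycle_of_neg W0.len W0 le_rfl h0
      have h1 := class_neg hω hf P C hC.2 (hu _ C hC) W0 h0
      have h2 := sub_mem h1 (edgeSum_sub_tS (ω := ω) (f := f) W0)
      obtain ⟨x, hx⟩ := h2
      refine ⟨x, fun W => ?_⟩
      simp only [doubleHom, AddMonoidHom.mk'_apply] at hx
      rcases Int.units_eq_one_or W.sgn with h3 | h3
      · simp [h3, tS_pos hω hf W h3]
      · have h4 := tS_pos hω hf (W.append W0) (by simp [h3, h0])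
        simp [tS_append, h3] at h4
        simp only [h3, act_neg_one]
        grind
    · refine ⟨0, fun W => ?_⟩
      have h3 : W.sgn = 1 := (Int.units_eq_one_or W.sgn).resolve_right (fun h => hc ⟨W, h⟩)
      simp [h3, tS_pos hω hf W h3]
  choose x hx using hx
  let g : V → G := fun v => (toRoot Γ v).tensionSum ω f + act u (toRoot Γ v).sgn (x (Γ.comp v))
  have key : ∀ (v : V) (c : Γ.Components) (_ : Γ.comp v = c) (W : Γ.Walk v (root c)),
      g v = W.tensionSum ω f + act u W.sgn (x c) := by
    rintro v _ rfl W
    have h1 := hx _ ((toRoot Γ v).rev.append W)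
    have h2 := tS_rev (f := f) hω (toRoot Γ v)
    rw [tS_append, sgn_append, act_mul, sgn_rev] at h1
    simp only [g]
    generalize act u W.sgn (x (Γ.comp v)) = y at h1 ⊢
    generalize x (Γ.comp v) = z at h1 ⊢
    rw [h1]
    rcases Int.units_eq_one_or (toRoot Γ v).sgn with h3 | h3 <;> simp [h3] at h2 ⊢ <;> grind
  refine ⟨g, funext fun e => ?_⟩
  have h1 : Γ.comp (Γ.endpt e true) = Γ.comp (Γ.endpt e false) := comp_endpt e true
  have h2 := key (Γ.endpt e true) _ h1 (.cons e true (toRoot Γ (Γ.endpt e false)))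
  rw [tensionSum, sgn, act_mul, add_assoc, ← act_add] at h2
  have h3 := dl_step hω u g e true
  apply unit_smul_inj (ω e true)
  rw [h3, h2]
  simp [g]

end Colorings

end SGraph

attribute [local instance] Classical.propDecidable

namespace SGraph

section Counting

variable {V E : Type} {Γ : SGraph V E} {G : Type} [AddCommGroup G]
variable {ω : E → Bool → ℤˣ} {f : E → G}

open Walk

theorem dl_add (u : G) (g k : V → G) : Γ.dl ω u (g + k) = Γ.dl ω u g + Γ.dl ω 0 k := by
  funext e
  simp only [dl, Pi.add_apply, smul_add, smul_zero, ite_self, add_zero]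
  abel

theorem dl_zero_iff (hω : Γ.IsCompatible ω) (u : G) (k : V → G) :
    Γ.dl ω u k = 0 ↔ ∀ e, k (Γ.ends e).1 = act u (Γ.sign e) (k (Γ.ends e).2) := by
  rw [funext_iff]
  exact forall_congr' fun e => dl_eq_zero_iff hω u k e

theorem fiber (hω : Γ.IsCompatible ω) (u : G) (p : (E → G) → Prop) :
    Nat.card {g : V → G // p (Γ.dl ω u g)} =
      Nat.card {f : E → G // (∃ g, Γ.dl ω u g = f) ∧ p f} * Nat.card (Γ.Col (0 : G)) := by
  rw [← Nat.card_prod]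
  choose s hs using fun f : {f : E → G // (∃ g, Γ.dl ω u g = f) ∧ p f} => f.2.1
  have h1 : ∀ (q : {f : E → G // (∃ g, Γ.dl ω u g = f) ∧ p f} × Γ.Col (0 : G)),
      Γ.dl ω u (s q.1 + q.2.1) = q.1.1 := by
    intro q
    rw [dl_add, hs, (dl_zero_iff hω 0 _).2 q.2.2, add_zero]
  refine Nat.card_congr ⟨fun g => (⟨Γ.dl ω u g.1, ⟨g.1, rfl⟩, g.2⟩,
    ⟨g.1 - s ⟨Γ.dl ω u g.1, ⟨g.1, rfl⟩, g.2⟩, ?_⟩), fun q => ⟨s q.1 + q.2.1, ?_⟩, ?_, ?_⟩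
  · refine (dl_zero_iff hω 0 _).1 ?_
    have h := dl_add (Γ := Γ) (ω := ω) u (s ⟨Γ.dl ω u g.1, ⟨g.1, rfl⟩, g.2⟩)
      (g.1 - s ⟨Γ.dl ω u g.1, ⟨g.1, rfl⟩, g.2⟩)
    rw [add_sub_cancel, hs] at h
    simpa using h
  · rw [h1]; exact q.1.2.2
  · intro g
    apply Subtype.ext
    simp
  · intro q
    have h2 : (⟨Γ.dl ω u (s q.1 + q.2.1), ⟨_, rfl⟩, by rw [h1]; exact q.1.2.2⟩ :
        {f : E → G // (∃ g, Γ.dl ω u g = f) ∧ p f}) = q.1 := Subtype.ext (h1 q)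
    refine Prod.ext h2 (Subtype.ext ?_)
    simp only [h2]
    simp

theorem isClass_iff (hω : Γ.IsCompatible ω) (u : G) (f : E → G) :
    Γ.IsClass ω u f ↔ ∃ g, Γ.dl ω u g = f := by
  constructor
  · exact exists_dl hω
  · rintro ⟨g, rfl⟩
    exact dl_isClass hω u g

/-- Inclusion–exclusion. -/
theorem incl_excl [Finite V] [Fintype E] [Finite G] (hω : Γ.IsCompatible ω) (u : G) :
    (Nat.card {g : V → G // ∀ e, Γ.dl ω u g e ≠ 0} : ℚ) =
      ∑ A : Finset E, (-1) ^ A.card * (Nat.card ((Γ.restrict (A : Set E)).Col u) : ℚ) := by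
  have := Fintype.ofFinite (V → G)
  have h1 : ∀ A : Finset E, (Nat.card ((Γ.restrict (A : Set E)).Col u) : ℚ) =
      ∑ g : V → G, if A ⊆ Finset.univ.filter (fun e => Γ.dl ω u g e = 0) then 1 else 0 := by
    intro A
    rw [Finset.sum_boole, Nat.cast_inj, ← Fintype.card_subtype, ← Nat.card_eq_fintype_card]
    refine Nat.card_congr (Equiv.subtypeEquivRight fun g => ?_)
    simp only [Finset.subset_iff, Finset.mem_filter, Finset.mem_univ, true_and,
      dl_eq_zero_iff hω, restrict, Subtype.forall, Finset.mem_coe]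
  simp only [h1, Finset.mul_sum]
  rw [Finset.sum_comm]
  rw [Nat.card_eq_fintype_card, Fintype.card_subtype, ← Finset.sum_boole]
  refine Finset.sum_congr rfl fun g _ => ?_
  have h2 := Finset.sum_powerset_neg_one_pow_card
    (x := Finset.univ.filter (fun e => Γ.dl ω u g e = 0))
  have h3 := congrArg (Int.cast : ℤ → ℚ) h2
  push_cast at h3
  simp only [mul_ite, mul_one, mul_zero]
  rw [← Finset.sum_filter]
  have h4 : (Finset.univ.filter fun A : Finset E =>
      A ⊆ Finset.univ.filter (fun e => Γ.dl ω u g e = 0)) =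
      (Finset.univ.filter (fun e => Γ.dl ω u g e = 0)).powerset := by
    ext A; simp
  rw [h4, h3]
  simp [Finset.filter_eq_empty_iff]

theorem rank_le [Finite V] [Finite E] (Γ : SGraph V E) : Nat.card V ≤ Nat.card E + Γ.kb := by
  have := Fintype.ofFinite V
  have := Fintype.ofFinite E
  let ω : E → Bool → ℤˣ := fun e b => if b then 1 else - Γ.sign e
  have hω : Γ.IsCompatible ω := fun e => by simp [ω]
  have h := fiber (G := ZMod 3) hω 0 (fun _ => True)
  rw [card_col] at h
  have h1 : Nat.card {x : ZMod 3 // act 0 (-1) x = x} = 1 := by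
    rw [Nat.card_eq_one_iff_unique]
    have h0 : ∀ x : ZMod 3, -x = x → x = 0 := by decide
    exact ⟨⟨fun a b => Subtype.ext (by
      have ha := a.2; have hb := b.2
      simp at ha hb
      rw [h0 _ ha, h0 _ hb])⟩, ⟨⟨0, by simp⟩⟩⟩
  rw [h1, one_pow, mul_one] at h
  have h2 : Nat.card {g : V → ZMod 3 // True} = 3 ^ Nat.card V := by
    rw [Nat.card_congr (Equiv.subtypeUnivEquiv (by simp))]; simp
  have h3 : Nat.card {f : E → ZMod 3 // (∃ g, Γ.dl ω 0 g = f) ∧ True} ≤ 3 ^ Nat.card E := by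
    refine (Nat.card_le_card_of_injective _ Subtype.val_injective).trans ?_
    simp
  rw [h2] at h
  have h4 : 3 ^ Nat.card V ≤ 3 ^ (Nat.card E + Γ.kb) := by
    rw [h, pow_add]
    simp only [Nat.card_zmod]
    exact Nat.mul_le_mul_right _ h3
  exact (Nat.pow_le_pow_iff_right (by norm_num)).1 h4

theorem kAll_le_restrict [Finite V] (A : Set E) : Γ.kAll ≤ (Γ.restrict A).kAll := by
  refine Nat.card_le_card_of_surjective
    (Quot.map id (fun a b h => ?_) : (Γ.restrict A).Components → Γ.Components) ?_
  · obtain ⟨e, h⟩ := h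
    exact ⟨e.1, h⟩
  · intro c
    induction c using Quot.ind with | _ v => exact ⟨Quot.mk _ v, rfl⟩

theorem kAll_le [Finite V] : Γ.kAll ≤ Nat.card V :=
  Nat.card_le_card_of_surjective (Quot.mk _) Quot.mk_surjective

theorem unified [Finite V] [Finite E] [Finite G] (hω : Γ.IsCompatible ω) (u : G) (q : ℚ)
    (hq : (Nat.card {x : G // act u (-1) x = x} : ℚ) = Nat.card G * q)
    (h0 : (Nat.card {x : G // act (0 : G) (-1) x = x} : ℚ) * Nat.card (twoG G) = Nat.card G) :
    (Nat.card {f : E → G // Γ.IsClass ω u f ∧ ∀ e, f e ≠ 0} : ℚ) =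
      (-1 : ℚ) ^ (Nat.card V - Γ.kAll) * (Nat.card (twoG G) : ℚ) ^ Γ.ku *
        Γ.signedTutte (1 - (Nat.card G : ℚ)) 0 (1 - q) := by
  have := Fintype.ofFinite E
  have h1 := incl_excl hω u
  rw [fiber hω u (fun f => ∀ e, f e ≠ 0)] at h1
  simp only [← isClass_iff hω] at h1
  have hG : (Nat.card G : ℚ) ≠ 0 := by exact_mod_cast Nat.card_pos.ne'
  have hcol : (Nat.card (Γ.Col (0 : G)) : ℚ) * (Nat.card (twoG G) : ℚ) ^ Γ.ku
      = (Nat.card G : ℚ) ^ Γ.kAll := by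
    rw [card_col, ← kb_add_ku, pow_add]
    push_cast
    rw [mul_assoc, ← mul_pow, h0]
  have hcol0 : (Nat.card (Γ.Col (0 : G)) : ℚ) ≠ 0 := by
    intro h
    rw [h, zero_mul] at hcol
    exact pow_ne_zero _ hG hcol.symm
  apply mul_right_cancel₀ hcol0
  push_cast at h1
  rw [h1, signedTutte, finsum_eq_sum_of_fintype]
  have h2 : ∀ S : ℚ, (-1 : ℚ) ^ (Nat.card V - Γ.kAll) * (Nat.card (twoG G) : ℚ) ^ Γ.ku * S *
      (Nat.card (Γ.Col (0 : G)) : ℚ) =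
      (-1 : ℚ) ^ (Nat.card V - Γ.kAll) * (Nat.card G : ℚ) ^ Γ.kAll * S := by
    intro S
    rw [← hcol]; ring
  rw [h2, Finset.mul_sum]
  refine Finset.sum_congr rfl fun A _ => ?_
  rw [card_col]
  push_cast
  rw [hq]
  have e1 : (Γ.restrict (A : Set E)).kb + (Γ.restrict (A : Set E)).ku =
    (Γ.restrict (A : Set E)).kAll := kb_add_ku
  have e2 := kAll_le_restrict (Γ := Γ) (A : Set E)
  have e3 := kAll_le (Γ := Γ)
  have e4 := rank_le (Γ.restrict (A : Set E))
  have e5 : Nat.card (A : Set E) = A.card := by simp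
  rw [e5] at e4
  generalize (Γ.restrict (A : Set E)).kb = b at *
  generalize (Γ.restrict (A : Set E)).ku = m at *
  generalize (Γ.restrict (A : Set E)).kAll = n at *
  generalize A.card = c at *
  generalize Γ.kAll = k at *
  generalize Nat.card V = r at *
  generalize (Nat.card G : ℚ) = x at *
  obtain ⟨i, rfl⟩ := Nat.exists_eq_add_of_le e2
  obtain ⟨j, rfl⟩ := Nat.exists_eq_add_of_le e3
  obtain ⟨l, hl⟩ := Nat.exists_eq_add_of_le e4
  have t1 : k + i - k = i := by omega
  have t2 : k + j - k = j := by omega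
  have t3 : c + b - (k + j) = l := by omega
  rw [t1, t2, t3, show (1 - x - 1 : ℚ) = (-1) * x by ring, show (1 - q - 1 : ℚ) = (-1) * q by ring,
    show (0 - 1 : ℚ) = -1 by ring, mul_pow, mul_pow, mul_pow]
  have hs : (-1 : ℚ) ^ c = (-1) ^ j * (-1) ^ i * (-1) ^ l * (-1) ^ m := by
    rw [← pow_add, ← pow_add, ← pow_add, show j + i + l + m = c + 2 * i by omega, pow_add, pow_mul]
    norm_num
  have hx : x ^ b * x ^ m = x ^ k * x ^ i := by rw [← pow_add, ← pow_add, e1]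
  rw [hs]
  linear_combination ((-1) ^ j * (-1) ^ i * (-1) ^ l * (-1) ^ m * q ^ m) * hx

theorem fix_zero [Finite G] :
    (Nat.card {x : G // act (0 : G) (-1) x = x} : ℚ) * Nat.card (twoG G) = Nat.card G := by
  have h1 : Nat.card {x : G // act (0 : G) (-1) x = x} = Nat.card (doubleHom G).ker := by
    refine Nat.card_congr (Equiv.subtypeEquivRight fun x => ?_)
    simp only [act_neg_one, sub_zero, AddMonoidHom.mem_ker, doubleHom, AddMonoidHom.mk'_apply]
    rw [neg_eq_iff_add_eq_zero]
  have h2 : Nat.card (twoG G) = (doubleHom G).ker.index := by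
    rw [AddSubgroup.index_ker]; rfl
  rw [h1, h2]
  exact_mod_cast AddSubgroup.card_mul_index _

theorem fix_u {u : G} (hu : u ∉ twoG G) : Nat.card {x : G // act u (-1) x = x} = 0 := by
  have : IsEmpty {x : G // act u (-1) x = x} := by
    refine ⟨fun x => hu ?_⟩
    have h := x.2
    rw [act_neg_one] at h
    have h2 := neg_mem (mem_twoG_add x.1)
    convert h2 using 1
    grind
  exact Nat.card_of_isEmpty

theorem twoG_ne [Finite G] : (Nat.card (twoG G) : ℚ) ≠ 0 := by
  exact_mod_cast Nat.card_pos.ne'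

theorem part1 [Finite V] [Finite E] [Finite G] (hω : Γ.IsCompatible ω) :
    (Nat.card {f : E → G // Γ.IsClass ω (0 : G) f ∧ ∀ e, f e ≠ 0} : ℚ) =
      (-1 : ℚ) ^ (Nat.card V - Γ.kAll) * (Nat.card (twoG G) : ℚ) ^ Γ.ku *
        Γ.signedTutte (1 - (Nat.card G : ℚ)) 0 (1 - 1 / (Nat.card (twoG G) : ℚ)) := by
  refine unified hω 0 _ ?_ fix_zero
  rw [← fix_zero (G := G)]
  field_simp [twoG_ne (G := G)]

theorem part2 [Finite V] [Finite E] [Finite G] (hω : Γ.IsCompatible ω) {u : G} (hu : u ∉ twoG G) :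
    (Nat.card {f : E → G // Γ.IsClass ω u f ∧ ∀ e, f e ≠ 0} : ℚ) =
      (-1 : ℚ) ^ (Nat.card V - Γ.kAll) * (Nat.card (twoG G) : ℚ) ^ Γ.ku *
        Γ.signedTutte (1 - (Nat.card G : ℚ)) 0 1 := by
  have := unified hω u 0 (by rw [fix_u hu]; simp) fix_zero
  rwa [sub_zero] at this

theorem sum_classes [Finite V] [Finite E] [Finite G] (hω : Γ.IsCompatible ω)
    (hc : Γ.Connected) (hb : ¬ Γ.Balanced) (a b : ℚ)
    (ha : (Nat.card {f : E → G // Γ.IsClass ω (0 : G) f ∧ ∀ e, f e ≠ 0} : ℚ) = a)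
    (hb' : ∀ u ∉ twoG G, (Nat.card {f : E → G // Γ.IsClass ω u f ∧ ∀ e, f e ≠ 0} : ℚ) = b) :
    (Nat.card {f : E → G // Γ.IsTension ω f ∧ ∀ e, f e ≠ 0} : ℚ) =
      a + ((Nat.card G : ℚ) / (Nat.card (twoG G) : ℚ) - 1) * b := by
  have := Fintype.ofFinite (G ⧸ twoG G)
  have hsub : Subsingleton Γ.Components := by
    have := (Nat.card_eq_one_iff_unique.1 hc).1
    exact this
  unfold Balanced at hb
  push Not at hb
  obtain ⟨v0, C, hC, hs⟩ := hb
  replace hs := (Int.units_eq_one_or C.sgn).resolve_left hs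
  let T := {f : E → G // Γ.IsTension ω f ∧ ∀ e, f e ≠ 0}
  let φ : T → G ⧸ twoG G := fun f => QuotientAddGroup.mk (C.edgeSum f.1)
  have h1 : ∀ u : G, Nat.card {f : T // φ f = QuotientAddGroup.mk u} =
      Nat.card {f : E → G // Γ.IsClass ω u f ∧ ∀ e, f e ≠ 0} := by
    intro u
    refine Nat.card_congr ((Equiv.subtypeSubtypeEquivSubtypeExists _ _).trans
      (Equiv.subtypeEquivRight fun f => ?_))
    constructor
    · rintro ⟨⟨hf, hz⟩, h⟩
      refine ⟨⟨hf, fun v W hW => ?_⟩, hz⟩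
      obtain ⟨P⟩ := walk_of_comp (Subsingleton.elim (Γ.comp v) (Γ.comp v0))
      refine class_neg hω hf P C hs ?_ W hW.2
      have h' := QuotientAddGroup.eq.1 h.symm
      rwa [neg_add_eq_sub] at h'
    · rintro ⟨⟨hf, hu⟩, hz⟩
      refine ⟨⟨hf, hz⟩, ?_⟩
      refine (QuotientAddGroup.eq.2 ?_).symm
      rw [neg_add_eq_sub]
      exact hu _ C ⟨hC, hs⟩
  have h2 : Nat.card T = ∑ c : G ⧸ twoG G, Nat.card {f : T // φ f = c} := by
    rw [← Nat.card_sigma]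
    exact Nat.card_congr (Equiv.sigmaFiberEquiv φ).symm
  have h3 : ∀ c : G ⧸ twoG G, (Nat.card {f : T // φ f = c} : ℚ) = b + if c = 0 then a - b else 0 := by
    intro c
    induction c using QuotientAddGroup.induction_on with | _ u => 
    by_cases hu : u ∈ twoG G
    · have h4 : (QuotientAddGroup.mk u : G ⧸ twoG G) = 0 := (QuotientAddGroup.eq_zero_iff u).2 hu
      rw [if_pos h4, h4]
      have h5 := h1 0
      rw [QuotientAddGroup.mk_zero] at h5
      rw [h5, ha]; ring
    · have h4 : (QuotientAddGroup.mk u : G ⧸ twoG G) ≠ 0 :=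
        fun h => hu ((QuotientAddGroup.eq_zero_iff u).1 h)
      rw [if_neg h4, h1 u, hb' u hu, add_zero]
  change (Nat.card T : ℚ) = _
  rw [h2]
  push_cast
  simp only [h3]
  rw [Finset.sum_add_distrib, Finset.sum_ite_eq' Finset.univ (0 : G ⧸ twoG G) (fun _ => a - b)]
  simp only [Finset.mem_univ, if_true, Finset.sum_const, Finset.card_univ, nsmul_eq_mul]
  have h6 : (Nat.card G : ℚ) = Fintype.card (G ⧸ twoG G) * Nat.card (twoG G) := by
    rw [← Nat.card_eq_fintype_card]
    exact_mod_cast AddSubgroup.card_eq_card_quotient_mul_card_addSubgroup (twoG G)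
  rw [h6, mul_div_assoc, div_self twoG_ne]
  ring

theorem ku_eq_one (hc : Γ.Connected) (hb : ¬ Γ.Balanced) : Γ.ku = 1 := by
  have hsub : Subsingleton Γ.Components := (Nat.card_eq_one_iff_unique.1 hc).1
  unfold Balanced at hb
  push Not at hb
  obtain ⟨v0, C, hC, hs⟩ := hb
  refine Nat.card_eq_one_iff_unique.2 ⟨inferInstance, ⟨⟨Γ.comp v0, fun h => hs (h _ rfl C hC)⟩⟩⟩

end Counting

end SGraph

section Statement

open SGraph

/-- Theorem 7.11: enumeration of nowhere-zero `G`-potential differences, of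
nowhere-zero `G`-tensions in a fixed nontrivial coset of `2G`, and (for
connected unbalanced signed graphs) of all nowhere-zero `G`-tensions, in terms
of the signed Tutte polynomial. -/
theorem card_nowhereZero_tensions (V E : Type) [Finite V] [Finite E]
    (Γ : SGraph V E) (ω : E → Bool → ℤˣ) (hω : Γ.IsCompatible ω)
    (G : Type) [AddCommGroup G] [Finite G] :
    -- nowhere-zero G-potential differences
    ((Nat.card {f : E → G // Γ.IsPotentialDifference ω f ∧ ∀ e : E, f e ≠ 0} : ℚ) =
      (-1 : ℚ) ^ (Nat.card V - Γ.kAll) * (Nat.card (twoG G) : ℚ) ^ Γ.ku *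
        Γ.signedTutte (1 - (Nat.card G : ℚ)) 0 (1 - 1 / (Nat.card (twoG G) : ℚ))) ∧
    -- nowhere-zero G-tensions in the coset u + 2G, for u ∉ 2G
    (∀ u : G, u ∉ twoG G →
      (Nat.card {f : E → G // Γ.IsTension ω f ∧ (∀ e : E, f e ≠ 0) ∧
          ∀ (v : V) (W : Γ.Walk v v), Γ.IsUnbalancedCycle W →
            W.edgeSum f - u ∈ twoG G} : ℚ) =
        (-1 : ℚ) ^ (Nat.card V - Γ.kAll) * (Nat.card (twoG G) : ℚ) ^ Γ.ku *
          Γ.signedTutte (1 - (Nat.card G : ℚ)) 0 1) ∧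
    -- all nowhere-zero G-tensions, when Σ is connected and unbalanced
    (Γ.Connected → ¬ Γ.Balanced →
      (Nat.card {f : E → G // Γ.IsTension ω f ∧ ∀ e : E, f e ≠ 0} : ℚ) =
        (-1 : ℚ) ^ (Nat.card V - Γ.kAll) * (Nat.card (twoG G) : ℚ) *
          (Γ.signedTutte (1 - (Nat.card G : ℚ)) 0 (1 - 1 / (Nat.card (twoG G) : ℚ)) +
            ((Nat.card G : ℚ) / (Nat.card (twoG G) : ℚ) - 1) *
              Γ.signedTutte (1 - (Nat.card G : ℚ)) 0 1)) := by
  refine ⟨?_, fun u hu => ?_, fun hc hb => ?_⟩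
  · rw [← part1 hω]
    simp only [IsPotentialDifference, IsClass, sub_zero]
  · rw [← part2 hω hu]
    congr 1
    refine Nat.card_congr (Equiv.subtypeEquivRight fun f => ?_)
    simp only [IsClass]
    tauto
  · rw [sum_classes hω hc hb _ _ (part1 hω) (fun u hu => part2 hω hu), ku_eq_one hc hb]
    ring

end Statement
end

section
/- Let M₁=(E,r₁) and M₂=(E,r₂) be matroids on a common finite ground set E, with duals M₁*=(E,r₁*) and M₂*=(E,r₂*). Then, as an identity of field-valued functions, for all X, Y, Z with Z ≠ 1: S_{M₂*,M₁*}(X, Y, Z) = (Z−1)^{|E|} · S_{M₁,M₂}(Y, X, Z/(Z−1)). -/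
noncomputable section Matroids

/-- A matroid on a finite ground set `E`, presented by its rank function. -/
structure RankMatroid (E : Type*) [Fintype E] [DecidableEq E] where
  r : Finset E → ℕ
  rank_le_card : ∀ A : Finset E, r A ≤ A.card
  rank_mono : ∀ ⦃A B : Finset E⦄, A ⊆ B → r A ≤ r B
  rank_submodular : ∀ A B : Finset E, r (A ∪ B) + r (A ∩ B) ≤ r A + r B

/-- The rank function of the dual matroid: `r*(A) = r(Aᶜ) + |A| − r(E)`. -/
def RankMatroid.dualRank {E : Type*} [Fintype E] [DecidableEq E] (M : RankMatroid E) :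
    Finset E → ℕ :=
  fun A => (M.r Aᶜ + A.card) - M.r Finset.univ

/-- The Tutte polynomial of a rank function:
`T(X,Y) = Σ_{A⊆E} (X−1)^{r(E)−r(A)} (Y−1)^{|A|−r(A)}`. -/
def tutteFn {E : Type*} [Fintype E] {K : Type*} [Field K]
    (r : Finset E → ℕ) (x y : K) : K :=
  ∑ A : Finset E, (x - 1) ^ (r Finset.univ - r A) * (y - 1) ^ (A.card - r A)

/-- The joint Tutte polynomial of an ordered pair of rank functions on a common
ground set: `S(X,Y,Z) = Σ_{A⊆E} (X−1)^{r₁(E)−r₁(A)} (Y−1)^{|A|−r₂(A)}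
(Z−1)^{r₂(A)+r₁(E)−r₁(A)}`. -/
def jointTutteFn {E : Type*} [Fintype E] {K : Type*} [Field K]
    (r₁ r₂ : Finset E → ℕ) (x y z : K) : K :=
  ∑ A : Finset E,
    (x - 1) ^ (r₁ Finset.univ - r₁ A) * (y - 1) ^ (A.card - r₂ A) *
      (z - 1) ^ ((r₂ A + r₁ Finset.univ) - r₁ A)

end Matroids

section Statement

theorem RankMatroid.univ_le_aux {E : Type} [Fintype E] [DecidableEq E] (M : RankMatroid E)
    (B : Finset E) : M.r Finset.univ ≤ M.r B + (Bᶜ).card := by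
  have h := M.rank_submodular B Bᶜ
  have h2 := M.rank_le_card Bᶜ
  rw [Finset.union_compl] at h
  omega

/-- Proposition 3.2, first duality formula:
`S_{M₂*,M₁*}(X,Y,Z) = (Z−1)^{|E|} · S_{M₁,M₂}(Y,X,Z/(Z−1))`. -/
theorem jointTutte_duality_one (E : Type) [Fintype E] [DecidableEq E]
    (K : Type) [Field K] (M₁ M₂ : RankMatroid E)
    (x y z : K) (hz : z ≠ 1) :
    jointTutteFn M₂.dualRank M₁.dualRank x y z =
      (z - 1) ^ Fintype.card E * jointTutteFn M₁.r M₂.r y x (z / (z - 1)) := by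
  have hz1 : z - 1 ≠ 0 := sub_ne_zero.mpr hz
  have hinv : z / (z - 1) - 1 = (z - 1)⁻¹ := by field_simp; ring
  unfold jointTutteFn
  rw [Finset.mul_sum, hinv]
  refine Fintype.sum_equiv (Equiv.ofBijective _ compl_bijective) _ _ ?_
  intro A
  obtain ⟨B, rfl⟩ : ∃ B : Finset E, A = Bᶜ := ⟨Aᶜ, (compl_compl A).symm⟩
  simp only [Equiv.ofBijective_apply, RankMatroid.dualRank, compl_compl, Finset.compl_univ]
  have hc : B.card + (Bᶜ).card = Fintype.card E := Finset.card_add_card_compl B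
  have hu : (Finset.univ : Finset E).card = Fintype.card E := Finset.card_univ
  have a1 := M₁.univ_le_aux B
  have a2 := M₂.univ_le_aux B
  have b1 := M₁.rank_mono (Finset.subset_univ B)
  have b2 := M₂.rank_mono (Finset.subset_univ B)
  have c2 := M₂.rank_le_card B
  have d2 := M₂.rank_le_card Finset.univ
  have e2 : M₂.r ∅ = 0 := by simpa using M₂.rank_le_card ∅
  rw [e2, hu]
  have p1 : 0 + Fintype.card E - M₂.r Finset.univ
      - (M₂.r B + (Bᶜ).card - M₂.r Finset.univ) = B.card - M₂.r B := by omega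
  have p2 : (Bᶜ).card - (M₁.r B + (Bᶜ).card - M₁.r Finset.univ)
      = M₁.r Finset.univ - M₁.r B := by omega
  have p3 : Fintype.card E = (M₁.r B + (Bᶜ).card - M₁.r Finset.univ
      + (0 + Fintype.card E - M₂.r Finset.univ) - (M₂.r B + (Bᶜ).card - M₂.r Finset.univ))
      + (M₂.r B + M₁.r Finset.univ - M₁.r B) := by omega
  have key : (z - 1) ^ Fintype.card E * (z - 1)⁻¹ ^ (M₂.r B + M₁.r Finset.univ - M₁.r B)
      = (z - 1) ^ (M₁.r B + (Bᶜ).card - M₁.r Finset.univ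
      + (0 + Fintype.card E - M₂.r Finset.univ)
      - (M₂.r B + (Bᶜ).card - M₂.r Finset.univ)) := by
    rw [inv_pow, ← div_eq_mul_inv, div_eq_iff (pow_ne_zero _ hz1), ← pow_add, ← p3]
  rw [← key, p1, p2]
  ring

end Statement
end
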